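/- arXiv:2210.07869 — 2 statements merged into one kernel-verified Lean document; each statement's English description precedes it below -/
import Mathlib

section
/- Let G be a colored base graph, f : E → F_2, A = CFI(G,f), and w a tuple of edge vertices of A whose origins are the directed base edges (w_i, w'_i). For a base edge {u,v}, the two edge vertices with origin (u,v) lie in the same 1-orbit of (A, w) if and only if {u,v} lies on a cycle of the graph G minus the edges {w_i, w'_i}. -/
variable {V : Type*}

/-- A gadget vertex of the CFI graph over base graph `G`: a base vertex `u` together with an
assignment `S : V → F₂` supported on the neighbors of `u` with even sum. -/
def GadgetVert [Fintype V] (G : SimpleGraph V) : Type _ :=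
  {p : V × (V → ZMod 2) // (∀ w, ¬ G.Adj p.1 w → p.2 w = 0) ∧ ∑ w, p.2 w = 0}

/-- An edge vertex of the CFI graph: a directed base edge (its origin) and an index in `F₂`. -/
def EdgeVert (G : SimpleGraph V) : Type _ :=
  {e : V × V // G.Adj e.1 e.2} × ZMod 2

/-- The vertices of the CFI graph over `G`. -/
def CFIVert [Fintype V] (G : SimpleGraph V) : Type _ :=
  GadgetVert G ⊕ EdgeVert G

/-- Adjacency of the CFI graph `CFI(G, f)`: a gadget vertex `(u, S)` is adjacent to the edge
vertex with origin `(u, v)` and index `S v`; the edge vertices with origins `(u, v)` and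
`(v, u)` and indices `i`, `j` are matched iff `i + j = f {u,v}`. -/
def CFIAdj [Fintype V] (G : SimpleGraph V) (f : Sym2 V → ZMod 2) :
    CFIVert G → CFIVert G → Prop
  | Sum.inl g, Sum.inr e => g.val.1 = e.1.val.1 ∧ g.val.2 e.1.val.2 = e.2
  | Sum.inr e, Sum.inl g => g.val.1 = e.1.val.1 ∧ g.val.2 e.1.val.2 = e.2
  | Sum.inr e, Sum.inr e' =>
      e.1.val.1 = e'.1.val.2 ∧ e.1.val.2 = e'.1.val.1 ∧
        e.2 + e'.2 = f s(e.1.val.1, e.1.val.2)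
  | _, _ => False

/-- The CFI graph `CFI(G, f)`. -/
def CFIGraph [Fintype V] (G : SimpleGraph V) (f : Sym2 V → ZMod 2) :
    SimpleGraph (CFIVert G) :=
  SimpleGraph.fromRel (CFIAdj G f)

/-- The origin of a CFI vertex: the base vertex of a gadget vertex, or the directed base edge
of an edge vertex. -/
def CFIorigin [Fintype V] (G : SimpleGraph V) : CFIVert G → V ⊕ (V × V)
  | Sum.inl g => Sum.inl g.val.1
  | Sum.inr e => Sum.inr e.1.val

/-- The color of a CFI vertex induced by a coloring `col` of the base graph. -/
def CFIcolor [Fintype V] (G : SimpleGraph V) (col : V → ℕ) : CFIVert G → ℕ ⊕ (ℕ × ℕ)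
  | Sum.inl g => Sum.inl (col g.val.1)
  | Sum.inr e => Sum.inr (col e.1.val.1, col e.1.val.2)

open Finset in
theorem walk_row {V : Type*} [Fintype V] [DecidableEq V] {H : SimpleGraph V} {a b : V}
    (p : H.Walk a b) (x : V) :
    ∑ y, ((p.edges.count s(x, y) : ℕ) : ZMod 2) =
      (if x = a then 1 else 0) + (if x = b then 1 else 0) := by
  induction p with
  | nil => simp [CharTwo.add_self_eq_zero]
  | @cons a c b h p ih =>
    have hac : a ≠ c := h.ne
    simp only [SimpleGraph.Walk.edges_cons, List.count_cons, Nat.cast_add, Finset.sum_add_distrib, ih]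
    have h2 : ∑ y, (((if (s(a, c) == s(x, y)) = true then 1 else 0 : ℕ)) : ZMod 2)
        = (if x = a then 1 else 0) + (if x = c then 1 else 0) := by
      by_cases h1 : x = a
      · subst h1
        rw [Finset.sum_eq_single c]
        · simp [hac]
        · intro y _ hy
          simp [Ne.symm hy, hac.symm]
        · simp
      · by_cases h3 : x = c
        · subst h3
          rw [Finset.sum_eq_single a]
          · simp [h1]
          · intro y _ hy
            simp [Ne.symm hy, Ne.symm h1]
          · simp
        · simp only [h1, h3, if_false, add_zero]
          apply Finset.sum_eq_zero
          intro y _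
          have : ¬ (s(a, c) = s(x, y)) := by
            rw [Sym2.eq_iff]; rintro (⟨h, _⟩ | ⟨_, h⟩)
            · exact h1 h.symm
            · exact h3 h.symm
          simp [this]
    rw [h2]
    have := CharTwo.add_self_eq_zero (if x = c then (1 : ZMod 2) else 0)
    linear_combination this

/-- Edge vertex constructor. -/
def ev {V : Type*} [Fintype V] {G : SimpleGraph V} (x y : V) (h : G.Adj x y) (i : ZMod 2) :
    CFIVert G := Sum.inr (⟨(x, y), h⟩, i)

/-- Gadget vertex constructor. -/
def gv {V : Type*} [Fintype V] {G : SimpleGraph V} (x : V) (S : V → ZMod 2)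
    (h0 : ∀ w, ¬ G.Adj x w → S w = 0) (h1 : ∑ w, S w = 0) :
    CFIVert G := Sum.inl ⟨(x, S), h0, h1⟩

section basics
variable {V : Type*} [Fintype V] {G : SimpleGraph V} {f : Sym2 V → ZMod 2}

theorem cfi_cases (a : CFIVert G) :
    (∃ x S h0 h1, a = gv x S h0 h1) ∨ (∃ x y h i, a = ev x y h i) := by
  rcases a with ⟨⟨x, S⟩, h0, h1⟩ | ⟨⟨⟨x, y⟩, h⟩, i⟩
  · exact Or.inl ⟨x, S, h0, h1, rfl⟩
  · exact Or.inr ⟨x, y, h, i, rfl⟩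

theorem ev_inj {x y h i x' y' h' i'} (e : (ev x y h i : CFIVert G) = ev x' y' h' i') :
    x = x' ∧ y = y' ∧ i = i' := by
  have := Sum.inr.inj e
  have h1 := congrArg Prod.snd this
  have h2 := congrArg (fun z => (Prod.fst z).val) this
  simp only [Prod.mk.injEq] at h2
  exact ⟨h2.1, h2.2, h1⟩

theorem CFIAdj_symm {a b : CFIVert G} (h : CFIAdj G f a b) : CFIAdj G f b a := by
  rcases a with a | a <;> rcases b with b | b
  · exact h
  · exact h
  · exact h
  · obtain ⟨h1, h2, h3⟩ := h
    refine ⟨h2.symm, h1.symm, ?_⟩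
    rw [add_comm, h3, ← h1, ← h2, Sym2.eq_swap]

theorem cfi_adj {a b : CFIVert G} : (CFIGraph G f).Adj a b ↔ CFIAdj G f a b := by
  unfold CFIGraph
  rw [SimpleGraph.fromRel_adj]
  constructor
  · rintro ⟨_, h | h⟩
    · exact h
    · exact CFIAdj_symm h
  · intro h
    refine ⟨?_, Or.inl h⟩
    rintro rfl
    rcases a with a | a
    · exact h
    · exact a.1.2.ne h.1

theorem adj_ev_ev {x y h i x' y' h' i'} :
    (CFIGraph G f).Adj (ev x y h i) (ev x' y' h' i') ↔
      x = y' ∧ y = x' ∧ i + i' = f s(x, y) := cfi_adj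

theorem adj_gv_ev {x S h0 h1 x' y' h' i'} :
    (CFIGraph G f).Adj (gv x S h0 h1) (ev x' y' h' i') ↔
      x = x' ∧ S y' = i' := cfi_adj

/-- Kind: gadget vertices or edge vertices. -/
def cfiKind {V : Type*} [Fintype V] {G : SimpleGraph V} : CFIVert G → Bool
  | Sum.inl _ => true
  | Sum.inr _ => false

theorem kind_of_color {col : V → ℕ} {a b : CFIVert G}
    (h : CFIcolor G col a = CFIcolor G col b) : cfiKind a = cfiKind b := by
  rcases a with a | a <;> rcases b with b | b
  · rfl
  · exact absurd h (by simp [CFIcolor])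
  · exact absurd h (by simp [CFIcolor])
  · rfl

theorem exists_ev {a : CFIVert G} (h : cfiKind a = false) : ∃ x y h i, a = ev x y h i := by
  rcases cfi_cases a with ⟨x, S, h0, h1, rfl⟩ | h'
  · exact absurd h (by simp [cfiKind, gv])
  · exact h'

theorem exists_gv {a : CFIVert G} (h : cfiKind a = true) : ∃ x S h0 h1, a = gv x S h0 h1 := by
  rcases cfi_cases a with h' | ⟨x, S, h0, h1, rfl⟩
  · exact h'
  · exact absurd h (by simp [cfiKind, ev])

end basics

theorem cfi_core {V : Type*} [Fintype V] {G : SimpleGraph V} {f : Sym2 V → ZMod 2}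
    (φ : CFIGraph G f ≃g CFIGraph G f) (hk : ∀ x, cfiKind (φ x) = cfiKind x)
    (K : SimpleGraph V) (hKG : K ≤ G) (u v : V) (huv : G.Adj u v) (hv : ¬ K.Reachable u v)
    (s : V → V → ZMod 2) (hs0 : ∀ x y, ¬ G.Adj x y → s x y = 0)
    (hrow : ∀ x, ∑ y, s x y = 0)
    (hK : ∀ x y, K.Reachable u x → K.Adj x y → s x y + s y x = f s(x, y))
    (hB : ∀ x y (h : G.Adj x y), K.Reachable u x → ¬ K.Adj x y → (x, y) ≠ (u, v) →
      φ (ev x y h (s x y)) = ev x y h (s x y))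
    (hU : φ (ev u v huv (s u v)) = ev u v huv (s u v + 1)) : False := by
  classical
  have hg : ∀ x, ∃ p t h0 h1, φ (gv x (s x) (hs0 x) (hrow x)) = gv p t h0 h1 := fun x =>
    exists_gv (by rw [hk]; rfl)
  choose π t ht0 ht1 hφ using hg
  have hr : ∀ x y, ∃ z, ∀ h : G.Adj x y, ∃ h',
      φ (ev x y h (s x y)) = ev (π x) z h' (t x z) := by
    intro x y
    by_cases h : G.Adj x y
    · have hadj : (CFIGraph G f).Adj (gv x (s x) (hs0 x) (hrow x)) (ev x y h (s x y)) :=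
        adj_gv_ev.2 ⟨rfl, rfl⟩
      rw [← φ.map_adj_iff, hφ] at hadj
      obtain ⟨a, b, hab, i, he⟩ := exists_ev (a := φ (ev x y h (s x y))) (by rw [hk]; rfl)
      rw [he, adj_gv_ev] at hadj
      obtain ⟨rfl, rfl⟩ := hadj
      exact ⟨b, fun _ => ⟨hab, he⟩⟩
    · exact ⟨x, fun h' => absurd h' h⟩
  choose ρ hρ using hr
  have hρadj : ∀ x y, G.Adj x y → G.Adj (π x) (ρ x y) := fun x y h => (hρ x y h).1
  have hinj : ∀ x y y', G.Adj x y → G.Adj x y' → ρ x y = ρ x y' → y = y' := by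
    intro x y y' h h' e
    obtain ⟨h1, e1⟩ := hρ x y h
    obtain ⟨h2, e2⟩ := hρ x y' h'
    have : φ (ev x y h (s x y)) = φ (ev x y' h' (s x y')) := by
      rw [e1, e2]; congr 1; rw [e]
    exact (ev_inj (φ.injective this)).2.1
  have hsurj : ∀ x z, G.Adj (π x) z → ∃ y, G.Adj x y ∧ ρ x y = z := by
    intro x z h
    obtain ⟨a, ha⟩ := φ.surjective (ev (π x) z h (t x z))
    obtain ⟨x', y', h', i', rfl⟩ := exists_ev (a := a) (by rw [← hk, ha]; rfl)
    have hadj : (CFIGraph G f).Adj (gv x (s x) (hs0 x) (hrow x)) (ev x' y' h' i') := by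
      rw [← φ.map_adj_iff, hφ, ha]
      exact adj_gv_ev.2 ⟨rfl, rfl⟩
    obtain ⟨rfl, rfl⟩ := adj_gv_ev.1 hadj
    obtain ⟨h2, e2⟩ := hρ x y' h'
    exact ⟨y', h', (ev_inj (e2.symm.trans ha)).2.1⟩
  have hinterior : ∀ x y, K.Reachable u x → K.Adj x y →
      ρ x y = π y ∧ ρ y x = π x ∧ t x (π y) + t y (π x) = f s(π x, π y) := by
    intro x y hx hxy
    obtain ⟨h1, e1⟩ := hρ x y (hKG hxy)
    obtain ⟨h2, e2⟩ := hρ y x (hKG hxy.symm)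
    have hadj : (CFIGraph G f).Adj (ev x y (hKG hxy) (s x y)) (ev y x (hKG hxy.symm) (s y x)) :=
      adj_ev_ev.2 ⟨rfl, rfl, hK x y hx hxy⟩
    rw [← φ.map_adj_iff, e1, e2, adj_ev_ev] at hadj
    obtain ⟨h3, h4, h5⟩ := hadj
    rw [← h3, h4] at h5
    exact ⟨h4, h3.symm, h5⟩
  have huvK : ¬ K.Adj u v := fun h => hv h.reachable
  have hbd : ∀ x y, G.Adj x y → K.Reachable u x → ¬ K.Adj x y →
      π x = x ∧ ρ x y = y ∧ t x y = s x y + if (x, y) = (u, v) then 1 else 0 := by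
    intro x y h hx hxy
    obtain ⟨h1, e1⟩ := hρ x y h
    by_cases he : (x, y) = (u, v)
    · obtain ⟨rfl, rfl⟩ := Prod.mk.inj he
      rw [hU] at e1
      obtain ⟨h2, h3, h4⟩ := ev_inj e1
      rw [← h3] at h4
      simp [← h2, ← h3, ← h4]
    · rw [hB x y h hx hxy he] at e1
      obtain ⟨h2, h3, h4⟩ := ev_inj e1
      rw [← h3] at h4
      simp [← h2, ← h3, ← h4, he]
  let C : Finset V := Finset.univ.filter (fun x => K.Reachable u x)
  have memC : ∀ x, x ∈ C ↔ K.Reachable u x := by simp [C]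
  have hsub : ∀ z, K.Reachable u z → ∃ x, K.Reachable u x ∧ π x = z := by
    intro z hz
    rw [SimpleGraph.reachable_iff_reflTransGen] at hz
    induction hz with
    | refl => exact ⟨u, SimpleGraph.Reachable.refl _, (hbd u v huv (SimpleGraph.Reachable.refl _) huvK).1⟩
    | @tail z z' _ hzz ih =>
      obtain ⟨x, hx, rfl⟩ := ih
      obtain ⟨y, hy, hyz⟩ := hsurj x z' (hKG hzz)
      by_cases hxy : K.Adj x y
      · exact ⟨y, hx.trans hxy.reachable, (hinterior x y hx hxy).1.symm.trans hyz⟩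
      · obtain ⟨h1, h2, _⟩ := hbd x y hy hx hxy
        rw [h1, ← hyz, h2] at hzz
        exact absurd hzz hxy
  have hCsub : C ⊆ C.image π := by
    intro z hz
    obtain ⟨x, hx, rfl⟩ := hsub z ((memC z).1 hz)
    exact Finset.mem_image_of_mem _ ((memC x).2 hx)
  have hCeq : C = C.image π := Finset.eq_of_subset_of_card_le hCsub Finset.card_image_le
  have hπinj : Set.InjOn π C := by
    rw [← Finset.card_image_iff, ← hCeq]
  have hπC : ∀ x, K.Reachable u x → K.Reachable u (π x) := by
    intro x hx
    rw [← memC, hCeq]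
    exact Finset.mem_image_of_mem _ ((memC x).2 hx)
  have hπK : ∀ x y, K.Reachable u x → K.Adj x y → K.Adj (π x) (π y) := by
    intro x y hx hxy
    by_contra hcon
    have hGa : G.Adj (π x) (π y) := by
      have := hρadj x y (hKG hxy)
      rwa [(hinterior x y hx hxy).1] at this
    have hy := hx.trans hxy.reachable
    have hx' := hπC x hx
    have hy' := hπC y hy
    obtain ⟨h1, -, -⟩ := hbd _ _ hGa hx' hcon
    obtain ⟨h2, -, -⟩ := hbd _ _ hGa.symm hy' (fun h => hcon h.symm)
    have h3 : π x = x := hπinj ((memC _).2 hx') ((memC _).2 hx) h1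
    have h4 : π y = y := hπinj ((memC _).2 hy') ((memC _).2 hy) h2
    rw [h3, h4] at hcon
    exact hcon hxy
  -- final summation
  let q : V → V → ZMod 2 := fun x y => t x (ρ x y) + s (π x) (ρ x y)
  have hq : ∀ x, ∑ y ∈ Finset.univ.filter (fun y => G.Adj x y), q x y = 0 := by
    intro x
    have h1 : ∑ y ∈ Finset.univ.filter (fun y => G.Adj x y), q x y
        = ∑ z ∈ Finset.univ.filter (fun z => G.Adj (π x) z), (t x z + s (π x) z) := by
      apply Finset.sum_bij (fun y _ => ρ x y)
      · intro y hy
        simp only [Finset.mem_filter, Finset.mem_univ, true_and] at hy ⊢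
        exact hρadj x y hy
      · intro y hy y' hy' e
        simp only [Finset.mem_filter, Finset.mem_univ, true_and] at hy hy'
        exact hinj x y y' hy hy' e
      · intro z hz
        simp only [Finset.mem_filter, Finset.mem_univ, true_and] at hz
        obtain ⟨y, hy, e⟩ := hsurj x z hz
        exact ⟨y, by simpa using hy, e⟩
      · intro y _
        rfl
    rw [h1, Finset.sum_filter_of_ne, Finset.sum_add_distrib, ht1, hrow, add_zero]
    intro z _ hz
    by_contra hcon
    exact hz (by rw [ht0 x z hcon, hs0 _ _ hcon, add_zero])
  let D : Finset (V × V) := C.product Finset.univ |>.filter (fun p => G.Adj p.1 p.2)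
  have memD : ∀ p, p ∈ D ↔ K.Reachable u p.1 ∧ G.Adj p.1 p.2 := by
    intro p
    rw [Finset.mem_filter, Finset.product_eq_sprod, Finset.mem_product, memC]
    simp
  have hD : ∑ p ∈ D, q p.1 p.2 = 0 := by
    simp only [D]
    rw [Finset.sum_filter, Finset.product_eq_sprod, Finset.sum_product]
    apply Finset.sum_eq_zero
    intro x _
    have := hq x
    rw [Finset.sum_filter] at this
    exact this
  have hsplit : ∀ p ∈ D, q p.1 p.2 =
      (if p = (u, v) then 1 else 0) + (if K.Adj p.1 p.2 then q p.1 p.2 else 0) := by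
    rintro ⟨x, y⟩ hp
    obtain ⟨hx, hxy⟩ := (memD _).1 hp
    simp only at hx hxy ⊢
    by_cases h : K.Adj x y
    · have : (x, y) ≠ (u, v) := by
        rintro e
        obtain ⟨rfl, rfl⟩ := Prod.mk.inj e
        exact huvK h
      simp [h, this]
    · obtain ⟨h1, h2, h3⟩ := hbd x y hxy hx h
      simp only [q, h1, h2, h3, h, if_false, add_zero]
      have := CharTwo.add_self_eq_zero (s x y)
      linear_combination this
  have huD : (u, v) ∈ D := (memD _).2 ⟨SimpleGraph.Reachable.refl _, huv⟩
  have hzero : ∑ p ∈ D, (if K.Adj p.1 p.2 then q p.1 p.2 else 0) = 0 := by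
    apply Finset.sum_involution (fun p _ => if K.Adj p.1 p.2 then (p.2, p.1) else p)
    · rintro ⟨x, y⟩ hp
      obtain ⟨hx, -⟩ := (memD _).1 hp
      simp only at hx ⊢
      by_cases h : K.Adj x y
      · obtain ⟨h1, h2, h3⟩ := hinterior x y hx h
        have h4 := hK _ _ (hπC x hx) (hπK x y hx h)
        simp only [h, h.symm, if_true, q, h1, h2]
        have := CharTwo.add_self_eq_zero (f s(π x, π y))
        linear_combination this + h3 + h4
      · simp [h]
    · rintro ⟨x, y⟩ hp hne
      simp only at hne ⊢
      by_cases h : K.Adj x y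
      · simp only [h, if_true]
        intro e
        exact h.ne (Prod.mk.inj e).2
      · simp [h] at hne
    · rintro ⟨x, y⟩ hp
      obtain ⟨hx, -⟩ := (memD _).1 hp
      by_cases h : K.Adj x y
      · simp only [h, if_true]
        exact (memD _).2 ⟨hx.trans h.reachable, hKG h.symm⟩
      · simpa only [h, if_false] using hp
    · rintro ⟨x, y⟩ hp
      by_cases h : K.Adj x y
      · simp [h, h.symm]
      · simp [h]
  rw [Finset.sum_congr rfl hsplit, Finset.sum_add_distrib, hzero, add_zero,
    Finset.sum_ite_eq' D (u, v), if_pos huD] at hD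
  exact one_ne_zero hD

theorem cfi_exists_section {V : Type*} [Fintype V] (G K : SimpleGraph V) (hKG : K ≤ G)
    (f : Sym2 V → ZMod 2) (c : V → V → ZMod 2)
    (u v : V) (huv : G.Adj u v) (hv : ¬ K.Reachable u v) :
    ∃ s : V → V → ZMod 2, (∀ x y, ¬ G.Adj x y → s x y = 0) ∧ (∀ x, ∑ y, s x y = 0) ∧
      (∀ x y, K.Reachable u x → K.Adj x y → s x y + s y x = f s(x, y)) ∧
      (∀ x y, G.Adj x y → K.Reachable u x → ¬ K.Adj x y → (x, y) ≠ (u, v) → s x y = c x y) := by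
  classical
  obtain ⟨e, -⟩ : ∃ e : V ↪ ℕ, True := ⟨(Fintype.equivFin V).toEmbedding.trans Fin.valEmbedding, trivial⟩
  let h0 : V → V → ZMod 2 := fun x y =>
    if K.Adj x y then (if e x < e y then f s(x, y) else 0) else if G.Adj x y then c x y else 0
  let d : V → ZMod 2 := fun x => ∑ y, h0 x y
  let C : Finset V := Finset.univ.filter (fun x => K.Reachable u x)
  have memC : ∀ x, x ∈ C ↔ K.Reachable u x := by simp [C]
  have hw : ∀ x, ∃ g : V → V → ZMod 2, (∀ y z, g y z = g z y) ∧ (∀ y z, ¬ K.Adj y z → g y z = 0) ∧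
      (x ∈ C → ∀ z, ∑ y, g z y = (if z = x then 1 else 0) + (if z = u then 1 else 0)) := by
    intro x
    by_cases hx : K.Reachable u x
    · obtain ⟨p⟩ := hx.symm
      refine ⟨fun y z => ((p.edges.count s(y, z) : ℕ) : ZMod 2), ?_, ?_, fun _ z => walk_row p z⟩
      · intro y z
        change ((p.edges.count s(y, z) : ℕ) : ZMod 2) = ((p.edges.count s(z, y) : ℕ) : ZMod 2)
        rw [Sym2.eq_swap]
      · intro y z hyz
        have : s(y, z) ∉ p.edges := fun hm => hyz (p.adj_of_mem_edges hm)
        simp [List.count_eq_zero_of_not_mem this]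
    · exact ⟨fun _ _ => 0, fun _ _ => rfl, fun _ _ _ => rfl, fun h => absurd ((memC x).1 h) hx⟩
  choose g gsymm gsupp grow using hw
  let F : V → V → ZMod 2 := fun y z => ∑ x ∈ C, d x * g x y z
  have hFs : ∀ y z, F y z = F z y := fun y z =>
    Finset.sum_congr rfl (fun x _ => by rw [gsymm])
  have hF0 : ∀ y z, ¬ K.Adj y z → F y z = 0 := fun y z h =>
    Finset.sum_eq_zero (fun x _ => by rw [gsupp x y z h, mul_zero])
  have hFrow : ∀ z ∈ C, ∑ y, F z y = d z + if z = u then ∑ x ∈ C, d x else 0 := by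
    intro z hz
    simp only [F]
    rw [Finset.sum_comm]
    have : ∀ x ∈ C, ∑ y, d x * g x z y = (if z = x then d x else 0) + (if z = u then d x else 0) := by
      intro x hx
      rw [← Finset.mul_sum, grow x hx z, mul_add]
      simp
    rw [Finset.sum_congr rfl this, Finset.sum_add_distrib, Finset.sum_ite_eq, if_pos hz]
    split_ifs <;> simp
  have huvK : ¬ K.Adj u v := fun h => hv h.reachable
  refine ⟨fun x y => if x ∈ C then h0 x y + F x y +
    (if x = u then (if y = v then ∑ x ∈ C, d x else 0) else 0) else 0, ?_, ?_, ?_, ?_⟩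
  · intro x y hxy
    have hkxy : ¬ K.Adj x y := fun h => hxy (hKG h)
    have : ¬ (x = u ∧ y = v) := by
      rintro ⟨rfl, rfl⟩; exact hxy huv
    simp only [hF0 x y hkxy, h0, hkxy, hxy, if_false]
    split_ifs <;> simp_all
  · intro x
    by_cases hx : x ∈ C
    · simp only [hx, if_true, Finset.sum_add_distrib, hFrow x hx]
      have h1 := CharTwo.add_self_eq_zero (d x)
      have h2 := CharTwo.add_self_eq_zero (∑ x ∈ C, d x)
      change d x + _ + _ = 0
      by_cases hxu : x = u
      · simp only [hxu, if_true, Finset.sum_ite_eq', Finset.mem_univ] at h1 ⊢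
        linear_combination h1 + h2
      · simp only [hxu, if_false, Finset.sum_const_zero]
        linear_combination h1
    · simp [hx]
  · intro x y hx hxy
    have hy := hx.trans hxy.reachable
    have n1 : ¬ (x = u ∧ y = v) := by
      rintro ⟨rfl, rfl⟩; exact huvK hxy
    have n2 : ¬ (y = u ∧ x = v) := by
      rintro ⟨rfl, rfl⟩; exact huvK hxy.symm
    have z1 : (if x = u then (if y = v then ∑ x ∈ C, d x else 0) else 0) = 0 := by
      split_ifs <;> simp_all
    have z2 : (if y = u then (if x = v then ∑ x ∈ C, d x else 0) else 0) = 0 := by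
      split_ifs <;> simp_all
    simp only [(memC x).2 hx, (memC y).2 hy, if_true, z1, z2]
    have h1 := CharTwo.add_self_eq_zero (F x y)
    have h2 : h0 x y + h0 y x = f s(x, y) := by
      simp only [h0, hxy, hxy.symm, if_true]
      have hne : e x ≠ e y := fun h => hxy.ne (e.injective h)
      rcases lt_or_gt_of_ne hne with h | h
      · simp [h, h.le]
      · rw [if_neg (by omega), if_pos h, zero_add, Sym2.eq_swap]
    rw [hFs y x]
    linear_combination h1 + h2
  · intro x y hG hx hxy hne
    have z1 : (if x = u then (if y = v then ∑ x ∈ C, d x else 0) else 0) = 0 := by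
      split_ifs <;> simp_all
    simp only [(memC x).2 hx, if_true, z1, hF0 x y hxy, h0, hxy, hG, if_false, add_zero]

/-- The automorphism given by a flow `g`. -/
theorem cfi_exists_auto {V : Type*} [Fintype V] (G : SimpleGraph V) (f : Sym2 V → ZMod 2)
    (g : V → V → ZMod 2) (gs : ∀ x y, g x y = g y x) (g0 : ∀ x y, ¬ G.Adj x y → g x y = 0)
    (gr : ∀ x, ∑ y, g x y = 0) :
    ∃ φ : CFIGraph G f ≃g CFIGraph G f,
      (∀ col x, CFIcolor G col (φ x) = CFIcolor G col x) ∧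
      ∀ x y h i, φ (ev x y h i) = ev x y h (i + g x y) := by
  let F : CFIVert G → CFIVert G := fun a => match a with
    | Sum.inl p => Sum.inl ⟨(p.val.1, fun y => p.val.2 y + g p.val.1 y), by
        refine ⟨fun w hw => ?_, ?_⟩
        · simp only at hw ⊢
          rw [p.2.1 w hw, g0 _ _ hw, add_zero]
        · simp only [Finset.sum_add_distrib, p.2.2, gr, add_zero]⟩
    | Sum.inr q => Sum.inr (q.1, q.2 + g q.1.val.1 q.1.val.2)
  have hev : ∀ x y h i, F (ev x y h i) = ev x y h (i + g x y) := fun _ _ _ _ => rfl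
  have hFF : ∀ a, F (F a) = a := by
    rintro (⟨⟨x, S⟩, h0, h1⟩ | ⟨⟨⟨x, y⟩, h⟩, i⟩)
    · refine congrArg Sum.inl (Subtype.ext (Prod.ext rfl (funext fun y => ?_)))
      change S y + g x y + g x y = S y
      rw [add_assoc, CharTwo.add_self_eq_zero, add_zero]
    · refine congrArg Sum.inr (Prod.ext rfl ?_)
      change i + g x y + g x y = i
      rw [add_assoc, CharTwo.add_self_eq_zero, add_zero]
  have hA : ∀ a b, CFIAdj G f a b → CFIAdj G f (F a) (F b) := by
    rintro (⟨⟨x, S⟩, h0, h1⟩ | ⟨⟨⟨x, y⟩, h⟩, i⟩) (⟨⟨x', S'⟩, h0', h1'⟩ | ⟨⟨⟨x', y'⟩, h'⟩, i'⟩) H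
    · exact H
    · obtain ⟨e1, e2⟩ := H
      simp only at e1 e2
      subst e1 e2
      exact ⟨rfl, rfl⟩
    · obtain ⟨e1, e2⟩ := H
      simp only at e1 e2
      subst e1 e2
      exact ⟨rfl, rfl⟩
    · obtain ⟨e1, e2, e3⟩ := H
      simp only at e1 e2 e3
      subst e1 e2
      refine ⟨rfl, rfl, ?_⟩
      change i + g x y + (i' + g y x) = f s(x, y)
      rw [gs y x]
      have := CharTwo.add_self_eq_zero (g x y)
      linear_combination this + e3
  refine ⟨⟨⟨F, F, hFF, hFF⟩, ?_⟩, ?_, hev⟩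
  · intro a b
    rw [cfi_adj, cfi_adj]
    refine ⟨fun h => ?_, hA a b⟩
    have := hA _ _ h
    change CFIAdj G f (F (F a)) (F (F b)) at this
    rwa [hFF, hFF] at this
  · rintro col (a | a)
    · rfl
    · rfl

/-- Let `G` be a colored base graph, `f : E → F₂`, `A = CFI(G,f)`, and `w` a
tuple of edge vertices whose origins are the directed base edges `(o j).1, (o j).2`. For a
base edge `{u,v}`, the two edge vertices with origin `(u,v)` lie in the same 1-orbit of
`(A, w)` iff `{u,v}` lies on a cycle of `G` minus the edges `{(o j).1, (o j).2}`. -/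
theorem cfi_edge_vertices_same_orbit_iff {V : Type*} [Fintype V] [DecidableEq V]
    (G : SimpleGraph V) (hconn : G.Connected) (col : V → ℕ)
    (f : Sym2 V → ZMod 2)
    (u v : V) (huv : G.Adj u v)
    (m : ℕ) (w : Fin m → CFIVert G) (o : Fin m → V × V)
    (ho : ∀ j, ∃ (h : G.Adj (o j).1 (o j).2) (i : ZMod 2), w j = Sum.inr (⟨o j, h⟩, i)) :
    (∃ φ : CFIGraph G f ≃g CFIGraph G f,
        (∀ x, CFIcolor G col (φ x) = CFIcolor G col x) ∧
        (∀ j, φ (w j) = w j) ∧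
        φ (Sum.inr (⟨(u, v), huv⟩, 0)) = Sum.inr (⟨(u, v), huv⟩, 1)) ↔
      (∃ (a : V) (p : (G.deleteEdges {e | ∃ j, e = s((o j).1, (o j).2)}).Walk a a),
        p.IsCycle ∧ s(u, v) ∈ p.edges) := by
  constructor
  · rintro ⟨φ, hcol, hw, hφ⟩
    have hk : ∀ x, cfiKind (φ x) = cfiKind x := fun x => kind_of_color (hcol x)
    change φ (ev u v huv 0) = ev u v huv 1 at hφ
    by_contra hno
    have hfix : ∀ x y (h : G.Adj x y), (∃ j, s(x, y) = s((o j).1, (o j).2)) →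
        ∃ i, φ (ev x y h i) = ev x y h i := by
      rintro x y h ⟨j, hj⟩
      obtain ⟨h', i, hwj⟩ := ho j
      have hwj' : w j = ev (o j).1 (o j).2 h' i := hwj
      have hf := hw j
      rw [hwj'] at hf
      clear hwj hwj'
      generalize (o j).1 = a at hj h' hf
      generalize (o j).2 = b at hj h' hf
      rcases Sym2.eq_iff.1 hj with ⟨rfl, rfl⟩ | ⟨rfl, rfl⟩
      · exact ⟨i, hf⟩
      · refine ⟨f s(x, y) - i, ?_⟩
        have hadj : (CFIGraph G f).Adj (ev x y h (f s(x, y) - i)) (ev y x h' i) :=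
          adj_ev_ev.2 ⟨rfl, rfl, by ring⟩
        rw [← φ.map_adj_iff, hf] at hadj
        obtain ⟨a, b, hab, k, he⟩ := exists_ev (a := φ (ev x y h (f s(x, y) - i)))
          (by rw [hk]; rfl)
        rw [he] at hadj ⊢
        obtain ⟨rfl, rfl, h3⟩ := adj_ev_ev.1 hadj
        rw [← h3]
        congr 1
        ring
    set W : Set (Sym2 V) := {e | ∃ j, e = s((o j).1, (o j).2)} with hW
    have huvW : s(u, v) ∉ W := by
      intro hmem
      obtain ⟨i, hi⟩ := hfix u v huv hmem
      have : i = 0 ∨ i = 1 := by clear hi; revert i; decide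
      rcases this with rfl | rfl
      · exact absurd (ev_inj (hφ.symm.trans hi)).2.2 (by decide)
      · exact absurd (ev_inj (φ.injective (hφ.trans hi.symm))).2.2 (by decide)
    have hadjH : (G.deleteEdges W).Adj u v := by
      rw [SimpleGraph.deleteEdges_adj]; exact ⟨huv, huvW⟩
    let K : SimpleGraph V := (G.deleteEdges W).deleteEdges {s(u, v)}
    have hKadj : ∀ x y, K.Adj x y ↔ G.Adj x y ∧ s(x, y) ∉ W ∧ s(x, y) ≠ s(u, v) := by
      intro x y
      simp only [K, SimpleGraph.deleteEdges_adj, Set.mem_singleton_iff, and_assoc, ne_eq]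
    have hKG : K ≤ G := fun x y h => ((hKadj x y).1 h).1
    have hv : ¬ K.Reachable u v := by
      have hb : (G.deleteEdges W).IsBridge s(u, v) := by
        rw [SimpleGraph.isBridge_iff_forall_cycle_notMem hadjH]
        intro a p hp hm
        exact hno ⟨a, p, hp, hm⟩
      exact SimpleGraph.isBridge_iff.1 hb
    have hc : ∀ x y, ∃ i, ∀ h : G.Adj x y, s(x, y) ∈ W → φ (ev x y h i) = ev x y h i := by
      intro x y
      by_cases h : G.Adj x y ∧ s(x, y) ∈ W
      · obtain ⟨i, hi⟩ := hfix x y h.1 h.2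
        exact ⟨i, fun _ _ => hi⟩
      · exact ⟨0, fun h1 h2 => absurd ⟨h1, h2⟩ h⟩
    choose c hc using hc
    obtain ⟨s, hs0, hrow, hsK, hsB⟩ := cfi_exists_section G K hKG f c u v huv hv
    have hB : ∀ x y (h : G.Adj x y), K.Reachable u x → ¬ K.Adj x y → (x, y) ≠ (u, v) →
        φ (ev x y h (s x y)) = ev x y h (s x y) := by
      intro x y h hx hxy hne
      have hmem : s(x, y) ∈ W := by
        by_contra hcon
        apply hxy
        refine (hKadj x y).2 ⟨h, hcon, fun he => ?_⟩
        rcases Sym2.eq_iff.1 he with ⟨rfl, rfl⟩ | ⟨rfl, rfl⟩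
        · exact hne rfl
        · exact hv hx
      rw [hsB x y h hx hxy hne]
      exact hc x y h hmem
    have hcase : ∀ i : ZMod 2, i = 0 ∨ i = 1 := by decide
    rcases hcase (s u v) with h | h
    · refine cfi_core φ hk K hKG u v huv hv s hs0 hrow hsK hB ?_
      rw [h, hφ, zero_add]
    · refine cfi_core φ.symm ?_ K hKG u v huv hv s hs0 hrow hsK ?_ ?_
      · intro x
        rw [← hk (φ.symm x), RelIso.apply_symm_apply]
      · intro x y h' hx hxy hne
        rw [RelIso.symm_apply_eq, hB x y h' hx hxy hne]
      · rw [h, RelIso.symm_apply_eq]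
        exact hφ.symm
  · rintro ⟨a, p, hp, hm⟩
    obtain ⟨φ, hcol, hev⟩ := cfi_exists_auto G f
      (fun x y => ((p.edges.count s(x, y) : ℕ) : ZMod 2))
      (fun x y => by
        change ((p.edges.count s(x, y) : ℕ) : ZMod 2) = ((p.edges.count s(y, x) : ℕ) : ZMod 2)
        rw [Sym2.eq_swap])
      (fun x y hxy => by
        have : s(x, y) ∉ p.edges := fun hm =>
          hxy ((SimpleGraph.deleteEdges_adj.1 (p.adj_of_mem_edges hm)).1)
        simp [List.count_eq_zero_of_not_mem this])
      (fun x => by rw [walk_row p x]; exact CharTwo.add_self_eq_zero _)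
    refine ⟨φ, hcol col, ?_, ?_⟩
    · intro j
      obtain ⟨h', i, hwj⟩ := ho j
      have hwj' : w j = ev (o j).1 (o j).2 h' i := hwj
      rw [hwj', hev]
      have : s((o j).1, (o j).2) ∉ p.edges := fun hm =>
          ((SimpleGraph.deleteEdges_adj.1 (p.adj_of_mem_edges hm)).2 ⟨j, rfl⟩)
      simp [List.count_eq_zero_of_not_mem this]
    · refine (hev u v huv 0).trans ?_
      rw [List.count_eq_one_of_mem hp.edges_nodup hm]
      rw [Nat.cast_one, zero_add]
      rfl
end

section
/- For every k ≥ 3 there exist two finite asymmetric ternary structures A_k and B_k (with a total preorder) that are non-isomorphic but equivalent in the k-variable counting logic C^k, and a fixed 1-dimensional equivalence-free first-order interpretation Θ such that Θ(A_k) and Θ(B_k) are non-isomorphic CFI graphs over the same ordered base graph. -/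
variable {V : Type*}

/-- The relational signature with one binary relation `≼` and one ternary relation `R`. -/
def tsig : FirstOrder.Language where
  Functions := fun _ => Empty
  Relations := fun n =>
    match n with
    | 2 => Unit
    | 3 => Unit
    | _ => Empty

/-- The `tsig`-structure on `α` given by a ternary relation `R` and a binary relation `le`. -/
def tStruct {α : Type} (R : α → α → α → Prop) (le : α → α → Prop) :
    tsig.Structure α where
  funMap := fun {n} f _ => Empty.elim f
  RelMap := fun {n} r v =>
    match n, r, v with
    | 2, _, v => le (v 0) (v 1)
    | 3, _, v => R (v 0) (v 1) (v 2)
    | 0, r, _ => Empty.elim r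
    | 1, r, _ => Empty.elim r
    | (_ + 4), r, _ => Empty.elim r

/-- Realization of a `tsig`-formula in the structure given by `R` and `le`. -/
def realizeIn {α : Type} {ν : Type} (R : α → α → α → Prop) (le : α → α → Prop)
    (φ : tsig.Formula ν) (v : ν → α) : Prop :=
  letI := tStruct R le
  φ.Realize v

/-- The canonical total preorder on the vertices of a CFI graph over an ordered base graph,
refining the coloring by origins. -/
def cfiLe {VH : Type*} [Fintype VH] [LinearOrder VH] (H : SimpleGraph VH) :
    CFIVert H → CFIVert H → Prop :=
  fun x y =>
    match CFIorigin H x, CFIorigin H y with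
    | Sum.inl a, Sum.inl b => a ≤ b
    | Sum.inl _, Sum.inr _ => True
    | Sum.inr _, Sum.inl _ => False
    | Sum.inr p, Sum.inr q => p.1 < q.1 ∨ (p.1 = q.1 ∧ p.2 ≤ q.2)

/-- A tuple-pair is a partial isomorphism between the ternary structures with preorders
`(A, R_A, le_A)` and `(B, R_B, le_B)`. -/
def PartialIso {A B : Type} (RA : A → A → A → Prop) (leA : A → A → Prop)
    (RB : B → B → B → Prop) (leB : B → B → Prop) {k : ℕ}
    (α : Fin k → A) (β : Fin k → B) : Prop :=
  (∀ i j, α i = α j ↔ β i = β j) ∧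
  (∀ i j, leA (α i) (α j) ↔ leB (β i) (β j)) ∧
  (∀ i j t, RA (α i) (α j) (α t) ↔ RB (β i) (β j) (β t))

/-- Equivalence in the `k`-variable counting logic `C^k`, characterized by the existence of a
nonempty system of positions of the bijective `k`-pebble game on which Duplicator wins: every
position is a partial isomorphism, and for every position and every pebble pair there is a
bijection such that all Spoiler moves lead back into the system. -/
def CkEquiv (k : ℕ) {A B : Type} (RA : A → A → A → Prop) (leA : A → A → Prop)
    (RB : B → B → B → Prop) (leB : B → B → Prop) : Prop :=
  ∃ F : Set ((Fin k → A) × (Fin k → B)),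
    F.Nonempty ∧
    (∀ p ∈ F, PartialIso RA leA RB leB p.1 p.2) ∧
    (∀ p ∈ F, ∀ i : Fin k, ∃ f : A ≃ B,
      ∀ x : A, (Function.update p.1 i x, Function.update p.2 i (f x)) ∈ F)

/-- The structure `(A, R, le)` is asymmetric: its only automorphism is the identity. -/
def Asymmetric {A : Type} (R : A → A → A → Prop) (le : A → A → Prop) : Prop :=
  ∀ φ : A ≃ A,
    (∀ a b c, R (φ a) (φ b) (φ c) ↔ R a b c) →
    (∀ a b, le (φ a) (φ b) ↔ le a b) →
    φ = Equiv.refl A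

/-- The image of `(A, R, le)` under the 1-dimensional equivalence-free interpretation
`(φdom, φE, φle)` is isomorphic to the CFI graph `CFI(H, f)` with its canonical
preorder. -/
def InterpIsoCFI {A : Type} (R : A → A → A → Prop) (le : A → A → Prop)
    (φdom : tsig.Formula (Fin 1)) (φE φle : tsig.Formula (Fin 2))
    {VH : Type} [Fintype VH] [LinearOrder VH]
    (H : SimpleGraph VH) (f : Sym2 VH → ZMod 2) : Prop :=
  ∃ e : {x : A // realizeIn R le φdom (fun _ => x)} ≃ CFIVert H,
    (∀ x y, realizeIn R le φE ![x.val, y.val] ↔ (CFIGraph H f).Adj (e x) (e y)) ∧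
    (∀ x y, realizeIn R le φle ![x.val, y.val] ↔ cfiLe H (e x) (e y))

section MultipedePart

/-- The triple system `v` has only the trivial solution. -/
def SysInj {T X : Type} (v : T → Fin 3 → X) : Prop :=
  ∀ z : X → ZMod 2, (∀ t, ∑ j, z (v t j) = 0) → ∀ x, z x = 0

/-- A set of edges of a bipartite multigraph without vertices of degree one. -/
def IsCoreP {E W : Type} (p : Bool → E → W) (C : Finset E) : Prop :=
  ∀ e ∈ C, ∀ b, ∃ e' ∈ C, e' ≠ e ∧ p b e' = p b e

/-- End points of incidences. -/
def endp {T X : Type} (v : T → Fin 3 → X) : Bool → T × Fin 3 → T ⊕ X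
  | false, e => Sum.inl e.1
  | true, e => Sum.inr (v e.1 e.2)

/-- All nonempty cores have at least `m` edges. -/
def SysGirth {T X : Type} (v : T → Fin 3 → X) (m : ℕ) : Prop :=
  ∀ C : Finset (T × Fin 3), C.Nonempty → IsCoreP (endp v) C → m ≤ C.card

open Classical in
theorem prune_core {E W : Type} (p : Bool → E → W) (N : ℕ) :
    ∀ (D : Finset E), D.card ≤ N → D.Nonempty → ∀ (b0 : Bool) (w0 : W),
      (∀ e ∈ D, ∀ b, (b = b0 ∧ p b e = w0) ∨ ∃ e' ∈ D, e' ≠ e ∧ p b e' = p b e) →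
      ∃ C ⊆ D, C.Nonempty ∧ IsCoreP p C := by
  induction N with
  | zero =>
    intro D h1 h2
    simp at h1
    simp [h1] at h2
  | succ N ih =>
    intro D hN hne b0 w0 h
    by_cases hc : IsCoreP p D
    · exact ⟨D, subset_rfl, hne, hc⟩
    · unfold IsCoreP at hc
      push Not at hc
      obtain ⟨e, he, b, hb⟩ := hc
      have hbe : b = b0 ∧ p b e = w0 := by
        rcases h e he b with h1 | ⟨e', h1, h2, h3⟩
        · exact h1
        · exact absurd h3 (hb e' h1 h2)
      obtain ⟨rfl, rfl⟩ := hbe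
      have hcard : (D.erase e).card ≤ N := by
        rw [Finset.card_erase_of_mem he]; omega
      have hnb : (!b) ≠ b := by cases b <;> simp
      have hne' : (D.erase e).Nonempty := by
        rcases h e he (!b) with ⟨h1, _⟩ | ⟨e', h1, h2, h3⟩
        · exact absurd h1 hnb
        · exact ⟨e', Finset.mem_erase.2 ⟨h2, h1⟩⟩
      obtain ⟨C, hC, hC1, hC2⟩ := ih (D.erase e) hcard hne' (!b) (p (!b) e) (by
        intro e'' he'' b'
        have he''1 := Finset.mem_erase.1 he''
        by_cases hbb : b' = b
        · subst hbb
          right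
          have := hb e'' he''1.2 he''1.1
          rcases h e'' he''1.2 b' with h1 | ⟨e', h1, h2, h3⟩
          · exact absurd h1.2 this
          · refine ⟨e', Finset.mem_erase.2 ⟨?_, h1⟩, h2, h3⟩
            rintro rfl
            exact this h3.symm
        · have hb' : b' = !b := by cases b <;> cases b' <;> simp_all
          subst hb'
          by_cases hp : p (!b) e'' = p (!b) e
          · left; exact ⟨rfl, hp⟩
          · right
            rcases h e'' he''1.2 (!b) with h1 | ⟨e', h1, h2, h3⟩
            · exact absurd h1.1 hnb
            · refine ⟨e', Finset.mem_erase.2 ⟨?_, h1⟩, h2, h3⟩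
              rintro rfl
              exact hp h3.symm)
      exact ⟨C, hC.trans (Finset.erase_subset _ _), hC1, hC2⟩

open Classical in
theorem forest_count {E W : Type} [DecidableEq W] (p : Bool → E → W) (N : ℕ) :
    ∀ (D : Finset E), D.card ≤ N → D.Nonempty →
      (∀ C ⊆ D, C.Nonempty → ¬ IsCoreP p C) →
      D.card + 1 ≤ (D.image (p false)).card + (D.image (p true)).card := by
  induction N with
  | zero =>
    intro D h1 h2
    simp at h1
    simp [h1] at h2
  | succ N ih =>
    intro D hN hne h
    have hc := h D subset_rfl hne
    unfold IsCoreP at hc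
    push Not at hc
    obtain ⟨e, he, b, hb⟩ := hc
    have hcard : (D.erase e).card + 1 = D.card := Finset.card_erase_add_one he
    rcases (D.erase e).eq_empty_or_nonempty with hemp | hne'
    · have hD : D = {e} := by
        rw [← Finset.insert_erase he, hemp]; rfl
      simp [hD]
    · have h1 := ih (D.erase e) (by omega) hne'
        (fun C hC => h C (hC.trans (Finset.erase_subset _ _)))
      have hmono : ∀ b', ((D.erase e).image (p b')).card ≤ (D.image (p b')).card := fun b' =>
        Finset.card_le_card (Finset.image_subset_image (Finset.erase_subset _ _))
      have hstrict : ((D.erase e).image (p b)).card + 1 ≤ (D.image (p b)).card := by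
        apply Finset.card_lt_card
        refine ⟨Finset.image_subset_image (Finset.erase_subset _ _), fun hs => ?_⟩
        have := hs (Finset.mem_image_of_mem (p b) he)
        obtain ⟨e', he', h3⟩ := Finset.mem_image.1 this
        have := Finset.mem_erase.1 he'
        exact hb e' this.2 this.1 h3
      have h2 := hmono true
      have h3 := hmono false
      cases b <;> omega

open Classical in
/-- The mod-2 homology cover of a triple system. -/
noncomputable def coverSys {T X : Type} (v : T → Fin 3 → X) :
    (T × (T × Fin 3 → ZMod 2)) → Fin 3 → X × (T × Fin 3 → ZMod 2) :=
  fun tc j => (v tc.1 j, tc.2 + Pi.single (tc.1, j) 1)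

theorem zmod2_cases (a : ZMod 2) : a = 0 ∨ a = 1 := by
  revert a; decide

theorem zmod2_add_self (a : ZMod 2) : a + a = 0 := by
  revert a; decide

open Classical in
theorem coverSys_inj {T X : Type} [Finite T] (v : T → Fin 3 → X) (h : SysInj v) :
    SysInj (coverSys v) := by
  intro z hz
  by_contra hne
  have key : ∀ F : Finset (T × Fin 3), ∃ z : X × (T × Fin 3 → ZMod 2) → ZMod 2,
      (∀ t, ∑ j, z (coverSys v t j) = 0) ∧ (¬ ∀ x, z x = 0) ∧
      ∀ ε ∈ F, ∀ x c, z (x, c + Pi.single ε 1) = z (x, c) := by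
    intro F
    induction F using Finset.induction_on with
    | empty => exact ⟨z, hz, hne, by simp⟩
    | insert ε F hε ih =>
      obtain ⟨z, hz1, hz2, hz3⟩ := ih
      by_cases h0 : ∀ x c, z (x, c + Pi.single ε 1) = z (x, c)
      · refine ⟨z, hz1, hz2, ?_⟩
        intro eps2 heps2
        rcases Finset.mem_insert.1 heps2 with rfl | h'
        · exact h0
        · exact hz3 eps2 h'
      · refine ⟨fun xc => z xc + z (xc.1, xc.2 + Pi.single ε 1), ?_, ?_, ?_⟩
        · rintro ⟨t, c⟩
          rw [Finset.sum_add_distrib, hz1, zero_add]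
          have := hz1 (t, c + Pi.single ε 1)
          rw [← this]
          refine Finset.sum_congr rfl fun j _ => ?_
          simp only [coverSys]
          rw [add_right_comm]
        · intro hall
          apply h0
          intro x c
          have h1 := hall (x, c)
          simp only at h1
          have h2 : z (x, c) = - z (x, c + Pi.single ε 1) := eq_neg_of_add_eq_zero_left h1
          rw [h2, ZMod.neg_eq_self_mod_two]
        · intro eps2 heps2 x c
          simp only
          rcases Finset.mem_insert.1 heps2 with rfl | h'
          · have : c + Pi.single eps2 (1 : ZMod 2) + Pi.single eps2 1 = c := by
              funext i
              simp only [Pi.add_apply, add_assoc, zmod2_add_self, add_zero]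
            rw [this, add_comm]
          · rw [hz3 eps2 h', add_right_comm, hz3 eps2 h']
  have := Fintype.ofFinite T
  obtain ⟨z, hz1, hz2, hz3⟩ := key Finset.univ
  have hinv : ∀ (F : Finset (T × Fin 3)) (x) (c : T × Fin 3 → ZMod 2),
      z (x, ∑ ε ∈ F, Pi.single ε (c ε)) = z (x, 0) := by
    intro F x c
    induction F using Finset.induction_on with
    | empty => simp
    | insert ε F hε ih =>
      rw [Finset.sum_insert hε, add_comm]
      rcases zmod2_cases (c ε) with h | h
      · rw [h, Pi.single_zero, add_zero, ih]
      · rw [h, hz3 ε (Finset.mem_univ _), ih]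
  have hinv' : ∀ x c, z (x, c) = z (x, 0) := by
    intro x c
    rw [← hinv Finset.univ x c, Finset.univ_sum_single]
  apply hz2
  rintro ⟨x, c⟩
  rw [hinv']
  refine h (fun x => z (x, 0)) (fun t => ?_) x
  rw [← hz1 (t, 0)]
  refine Finset.sum_congr rfl fun j _ => ?_
  simp only [coverSys]
  rw [hinv' _ (_ + _)]

open Classical in
theorem cover_image_core {T X : Type} (v : T → Fin 3 → X)
    (C : Finset ((T × (T × Fin 3 → ZMod 2)) × Fin 3)) (hC : IsCoreP (endp (coverSys v)) C) :
    IsCoreP (endp v) (C.image fun e => (e.1.1, e.2)) := by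
  intro e he b
  obtain ⟨⟨⟨t, c⟩, j⟩, ha, rfl⟩ := Finset.mem_image.1 he
  obtain ⟨⟨⟨t', c'⟩, j'⟩, ha', hne, hp⟩ := hC _ ha b
  refine ⟨(t', j'), Finset.mem_image.2 ⟨_, ha', rfl⟩, ?_, ?_⟩
  · intro heq
    simp only [Prod.mk.injEq] at heq
    obtain ⟨rfl, rfl⟩ := heq
    apply hne
    cases b <;> simp [endp, coverSys] at hp <;> simp [hp]
  · cases b <;> simp [endp, coverSys] at hp ⊢ <;> simp [hp]

open Classical in
theorem coverSys_girth {T X : Type} (v : T → Fin 3 → X) (m : ℕ) (h : SysGirth v m) :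
    SysGirth (coverSys v) (m + 1) := by
  intro C hne hC
  by_contra hlt
  have hlt' : C.card ≤ m := by omega
  have hI := h _ (hne.image _) (cover_image_core v C hC)
  have hinj : Set.InjOn (fun e : (T × (T × Fin 3 → ZMod 2)) × Fin 3 => (e.1.1, e.2)) C :=
    Finset.card_image_iff.1 (le_antisymm Finset.card_image_le (hlt'.trans hI))
  obtain ⟨a, ha⟩ := hne
  have hoff : ∀ e ∈ C, e ≠ a →
      (Pi.single (e.1.1, e.2) 1 : T × Fin 3 → ZMod 2) (a.1.1, a.2) = 0 := by
    intro e he hea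
    apply Pi.single_eq_of_ne
    intro heq
    exact hea (hinj he ha heq.symm)
  obtain ⟨D0, hD0, hD1, hD2⟩ := prune_core (endp (coverSys v)) _
    (C.filter fun e => e ≠ a ∧ e.1.2 (a.1.1, a.2) = a.1.2 (a.1.1, a.2)) le_rfl
    (by
      obtain ⟨b, hb, hba, hb1⟩ := hC a ha false
      simp only [endp, Sum.inl.injEq] at hb1
      exact ⟨b, Finset.mem_filter.2 ⟨hb, hba, by rw [hb1]⟩⟩)
    false (endp (coverSys v) false a)
    (by
      intro e he b
      obtain ⟨he, hea, hec⟩ := Finset.mem_filter.1 he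
      obtain ⟨e', he', hne', hp⟩ := hC e he b
      cases b with
      | false =>
        by_cases h1 : e' = a
        · left; rw [← h1, hp]; exact ⟨rfl, rfl⟩
        · right
          refine ⟨e', Finset.mem_filter.2 ⟨he', h1, ?_⟩, hne', hp⟩
          simp only [endp, Sum.inl.injEq] at hp
          rw [hp, hec]
      | true =>
        right
        have hp' := hp
        simp only [endp, coverSys, Sum.inr.injEq, Prod.mk.injEq] at hp'
        have hc := congrFun hp'.2 (a.1.1, a.2)
        simp only [Pi.add_apply] at hc
        rw [hoff e he hea, add_zero, hec] at hc
        by_cases h1 : e' = a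
        · subst h1
          simp at hc
        · rw [hoff e' he' h1, add_zero] at hc
          exact ⟨e', Finset.mem_filter.2 ⟨he', h1, hc⟩, hne', hp⟩)
  have h2 := h _ (hD1.image _) (cover_image_core v D0 hD2)
  have h3 : (D0.image fun e => (e.1.1, e.2)).card ≤ D0.card := Finset.card_image_le
  have h4 : D0.card < C.card := by
    apply Finset.card_lt_card
    refine ⟨hD0.trans (Finset.filter_subset _ _), fun hs => ?_⟩
    have := (Finset.mem_filter.1 (hD0 (hs ha))).2.1
    exact this rfl
  omega

theorem exists_sys (m : ℕ) : ∃ (T X : Type) (_ : Finite T) (_ : Finite X) (_ : Nonempty X)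
    (v : T → Fin 3 → X), SysInj v ∧ SysGirth v m := by
  classical
  induction m with
  | zero =>
    refine ⟨Unit, Unit, inferInstance, inferInstance, inferInstance, fun _ _ => (), ?_, ?_⟩
    · intro z hz x
      have := hz ()
      simp only [Finset.sum_const, Finset.card_univ, Fintype.card_fin] at this
      revert this
      generalize z () = a
      revert a
      decide
    · intro C _ _
      exact Nat.zero_le _
  | succ m ih =>
    obtain ⟨T, X, hT, hX, hne, v, h1, h2⟩ := ih
    exact ⟨_, _, inferInstance, inferInstance, inferInstance, coverSys v, coverSys_inj v h1,
      coverSys_girth v m h2⟩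

open Classical in
/-- The boundary of a set of equations in the triple system. -/
noncomputable def sysBd {T X : Type} [Fintype T] (v : T → Fin 3 → X) (U : T → ZMod 2) (x : X) :
    ZMod 2 :=
  ∑ t, ∑ j, if v t j = x then U t else 0

open Classical in
theorem sys_expand {T X : Type} [Fintype T] [Fintype X] (v : T → Fin 3 → X) (m : ℕ)
    (h : SysGirth v m) (U : T → ZMod 2) (hU : U ≠ 0)
    (hc : 3 * (Finset.univ.filter fun t => U t ≠ 0).card < m) :
    (Finset.univ.filter fun t => U t ≠ 0).card + 2 ≤
      (Finset.univ.filter fun x => sysBd v U x ≠ 0).card := by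
  set S := Finset.univ.filter fun t => U t ≠ 0 with hS
  have hSne : S.Nonempty := by
    by_contra h0
    apply hU
    funext t
    by_contra ht
    exact h0 ⟨t, by simpa [hS] using ht⟩
  set D : Finset (T × Fin 3) := S ×ˢ Finset.univ with hD
  have hDc : D.card = 3 * S.card := by rw [hD, Finset.card_product]; simp [mul_comm]
  have hDne : D.Nonempty := hSne.product Finset.univ_nonempty
  have hfor := forest_count (endp v) _ D le_rfl hDne (by
    intro C hC hCne hcore
    have h1 := h C hCne hcore
    have h2 := Finset.card_le_card hC
    omega)
  have hl : (D.image (endp v false)).card ≤ S.card := by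
    have : D.image (endp v false) ⊆ S.image Sum.inl := by
      intro w hw
      obtain ⟨e, he, rfl⟩ := Finset.mem_image.1 hw
      exact Finset.mem_image.2 ⟨e.1, (Finset.mem_product.1 he).1, rfl⟩
    exact (Finset.card_le_card this).trans Finset.card_image_le
  set N : Finset X := D.image fun e => v e.1 e.2 with hN
  have hr : (D.image (endp v true)).card ≤ N.card := by
    have : D.image (endp v true) ⊆ N.image Sum.inr := by
      intro w hw
      obtain ⟨e, he, rfl⟩ := Finset.mem_image.1 hw
      exact Finset.mem_image.2 ⟨v e.1 e.2, Finset.mem_image_of_mem _ he, rfl⟩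
    exact (Finset.card_le_card this).trans Finset.card_image_le
  have hdeg : D.card = ∑ x ∈ N, (D.filter fun e => v e.1 e.2 = x).card :=
    Finset.card_eq_sum_card_fiberwise (fun e he => Finset.mem_image_of_mem _ he)
  have hbd : ∀ x, sysBd v U x = ((D.filter fun e => v e.1 e.2 = x).card : ZMod 2) := by
    intro x
    rw [Finset.card_filter, Nat.cast_sum, hD, Finset.sum_product, sysBd, hS, Finset.sum_filter]
    refine Finset.sum_congr rfl fun t _ => ?_
    rcases zmod2_cases (U t) with h | h
    · simp [h]
    · simp [h]
  have hge : ∑ x ∈ N, 2 ≤ ∑ x ∈ N, ((D.filter fun e => v e.1 e.2 = x).card +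
      if sysBd v U x ≠ 0 then 1 else 0) := by
    refine Finset.sum_le_sum fun x hx => ?_
    have hpos : 0 < (D.filter fun e => v e.1 e.2 = x).card := by
      obtain ⟨e, he, rfl⟩ := Finset.mem_image.1 hx
      exact Finset.card_pos.2 ⟨e, Finset.mem_filter.2 ⟨he, rfl⟩⟩
    split_ifs with h0
    · omega
    · rw [not_not, hbd, ZMod.natCast_eq_zero_iff] at h0
      have := Nat.le_of_dvd hpos h0
      omega
  rw [Finset.sum_add_distrib, ← hdeg, ← Finset.card_filter, Finset.sum_const, smul_eq_mul] at hge
  have hsub : (N.filter fun x => sysBd v U x ≠ 0).card ≤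
      (Finset.univ.filter fun x => sysBd v U x ≠ 0).card :=
    Finset.card_le_card (Finset.filter_subset_filter _ (Finset.subset_univ _))
  omega

theorem sys_distinct {T X : Type} (v : T → Fin 3 → X) (m : ℕ) (hm : 3 ≤ m)
    (h : SysGirth v m) (t : T) : v t 0 ≠ v t 1 := by
  classical
  intro heq
  have := h {(t, 0), (t, 1)} (by simp) (by
    intro e he b
    simp only [Finset.mem_insert, Finset.mem_singleton] at he
    rcases he with rfl | rfl
    · exact ⟨(t, 1), by simp, by simp, by cases b <;> simp [endp, heq]⟩
    · exact ⟨(t, 0), by simp, by simp, by cases b <;> simp [endp, heq]⟩)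
  have h2 : ({(t, 0), (t, 1)} : Finset (T × Fin 3)).card ≤ 2 := Finset.card_le_two
  omega

end MultipedePart

section ExtensionPart

/-- `y` satisfies all admissible consequences supported on `P`. -/
def OKy {G Var : Type} [AddCommGroup G] [Fintype Var] (bd : G →+ (Var → ZMod 2))
    (c : G →+ ZMod 2) (Adm : G → Prop) (y : Var → ZMod 2) (P : Finset Var) : Prop :=
  ∀ U, Adm U → (∀ v, v ∉ P → bd U v = 0) → ∑ v, bd U v * y v = c U

theorem OKy.mono {G Var : Type} [AddCommGroup G] [Fintype Var] {bd : G →+ (Var → ZMod 2)}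
    {c : G →+ ZMod 2} {Adm : G → Prop} {y : Var → ZMod 2} {P Q : Finset Var}
    (h : OKy bd c Adm y P) (hQ : Q ⊆ P) : OKy bd c Adm y Q :=
  fun U hU hs => h U hU fun v hv => hs v fun h' => hv (hQ h')

open Classical in
theorem OKy.ext_one {G Var : Type} [AddCommGroup G] [Fintype Var] {bd : G →+ (Var → ZMod 2)}
    {c : G →+ ZMod 2} {Adm : G → Prop} {K : ℕ}
    (hK : ∀ U U', Adm U → Adm U' → (Finset.univ.filter fun v => bd (U + U') v ≠ 0).card ≤ K →
      Adm (U + U'))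
    {y : Var → ZMod 2} {P : Finset Var} (h : OKy bd c Adm y P) (hP : P.card ≤ K)
    (x : Var) (hx : x ∉ P) :
    ∃ z, OKy bd c Adm (Function.update y x z) (insert x P) := by
  have hupd : ∀ (U : G) (z : ZMod 2), ∑ v, bd U v * Function.update y x z v =
      ∑ v, bd U v * y v + bd U x * (z - y x) := by
    intro U z
    have : ∀ v, bd U v * Function.update y x z v =
        bd U v * y v + (if v = x then bd U x * (z - y x) else 0) := by
      intro v
      by_cases hv : v = x
      · subst hv; simp; ring
      · simp [hv]
    simp_rw [this]
    rw [Finset.sum_add_distrib]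
    simp
  by_cases hex : ∃ U0, Adm U0 ∧ (∀ v, v ∉ insert x P → bd U0 v = 0) ∧ bd U0 x = 1
  · obtain ⟨U0, hA, hs, h1⟩ := hex
    refine ⟨y x + (c U0 - ∑ v, bd U0 v * y v), ?_⟩
    intro U hU hUs
    rw [hupd, add_sub_cancel_left]
    rcases zmod2_cases (bd U x) with h0 | h0
    · rw [h0, zero_mul, add_zero]
      apply h U hU
      intro v hv
      by_cases hvx : v = x
      · rw [hvx, h0]
      · exact hUs v (by simp [hvx, hv])
    · have hsupp : ∀ v, v ∉ P → bd (U + U0) v = 0 := by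
        intro v hv
        rw [map_add, Pi.add_apply]
        by_cases hvx : v = x
        · rw [hvx, h0, h1]; rfl
        · rw [hUs v (by simp [hvx, hv]), hs v (by simp [hvx, hv]), add_zero]
      have hadm : Adm (U + U0) := by
        apply hK U U0 hU hA
        refine le_trans (Finset.card_le_card ?_) hP
        intro v hv
        by_contra hvP
        exact (Finset.mem_filter.1 hv).2 (hsupp v hvP)
      have := h (U + U0) hadm hsupp
      simp only [map_add, Pi.add_apply, add_mul, Finset.sum_add_distrib] at this
      rw [h0, one_mul]
      have e1 : ∑ v, bd U v * y v = c U + c U0 - ∑ v, bd U0 v * y v := by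
        rw [← this]; ring
      rw [e1]
      have e2 := zmod2_add_self (c U0)
      have e3 := zmod2_add_self (∑ v, bd U0 v * y v)
      linear_combination e2 - e3
  · refine ⟨y x, ?_⟩
    rw [Function.update_eq_self]
    intro U hU hUs
    apply h U hU
    intro v hv
    by_cases hvx : v = x
    · rcases zmod2_cases (bd U x) with h0 | h0
      · rw [hvx, h0]
      · exact absurd ⟨U, hU, hUs, h0⟩ hex
    · exact hUs v (by simp [hvx, hv])

open Classical in
theorem OKy.ext {G Var : Type} [AddCommGroup G] [Fintype Var] {bd : G →+ (Var → ZMod 2)}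
    {c : G →+ ZMod 2} {Adm : G → Prop} {K : ℕ}
    (hK : ∀ U U', Adm U → Adm U' → (Finset.univ.filter fun v => bd (U + U') v ≠ 0).card ≤ K →
      Adm (U + U'))
    {y : Var → ZMod 2} {P : Finset Var} (h : OKy bd c Adm y P) (Q : Finset Var)
    (hP : P.card + Q.card ≤ K) :
    ∃ y', (∀ v ∈ P, y' v = y v) ∧ OKy bd c Adm y' (P ∪ Q) := by
  induction Q using Finset.induction_on with
  | empty => exact ⟨y, fun _ _ => rfl, by simpa using h⟩
  | insert x Q hx ih =>
    rw [Finset.card_insert_of_notMem hx] at hP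
    obtain ⟨y', h1, h2⟩ := ih (by omega)
    rw [Finset.union_insert]
    by_cases hxP : x ∈ P ∪ Q
    · rw [Finset.insert_eq_self.2 hxP]
      exact ⟨y', h1, h2⟩
    · obtain ⟨z, hz⟩ := h2.ext_one hK ((Finset.card_union_le _ _).trans (by omega)) x hxP
      refine ⟨_, fun v hv => ?_, hz⟩
      rw [Function.update_of_ne, h1 v hv]
      rintro rfl
      exact hxP (Finset.mem_union_left _ hv)

/-- The vertex part of the boundary. -/
def vBd {n : ℕ} (U : Fin n → ZMod 2) : Sym2 (Fin n) → ZMod 2 :=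
  Sym2.lift ⟨fun a b => U a + U b, fun _ _ => add_comm _ _⟩

theorem vBd_add {n : ℕ} (U U' : Fin n → ZMod 2) (e) : vBd (U + U') e = vBd U e + vBd U' e := by
  induction e using Sym2.ind with
  | _ a b => simp only [vBd, Sym2.lift_mk, Pi.add_apply]; ring

theorem sysBd_add {T X : Type} [Fintype T] (v : T → Fin 3 → X) (U U' : T → ZMod 2) (x : X) :
    sysBd v (U + U') x = sysBd v U x + sysBd v U' x := by
  classical
  unfold sysBd
  rw [← Finset.sum_add_distrib]
  refine Finset.sum_congr rfl fun t _ => ?_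
  rw [← Finset.sum_add_distrib]
  refine Finset.sum_congr rfl fun j _ => ?_
  split_ifs <;> simp

open Classical in
/-- The boundary map of the combined system. -/
noncomputable def bdG {n : ℕ} {T X : Type} [Fintype T] (v : T → Fin 3 → X) (x0 : X) :
    ((Fin n → ZMod 2) × (Sym2 (Fin n) → T → ZMod 2)) →+ (Sym2 (Fin n) × X → ZMod 2) :=
  AddMonoidHom.mk' (fun U p => (if p.2 = x0 then vBd U.1 p.1 else 0) + sysBd v (U.2 p.1) p.2) (by
    intro U U'
    funext p
    simp only [Prod.fst_add, Prod.snd_add, Pi.add_apply, vBd_add, sysBd_add]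
    split_ifs <;> ring)

/-- The right hand side of the combined system. -/
def rhsG {n : ℕ} {T : Type} (tw : Fin n → Fin n → ZMod 2) :
    ((Fin n → ZMod 2) × (Sym2 (Fin n) → T → ZMod 2)) →+ ZMod 2 :=
  AddMonoidHom.mk' (fun U => ∑ u, U.1 u * ∑ w, (if u = w then 0 else tw u w)) (by
    intro U U'
    simp only [Prod.fst_add, Pi.add_apply, add_mul, Finset.sum_add_distrib])

open Classical in
/-- Admissible sets of equations. -/
def AdmG {n : ℕ} {T : Type} [Fintype T] (k : ℕ)
    (U : (Fin n → ZMod 2) × (Sym2 (Fin n) → T → ZMod 2)) : Prop :=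
  (Finset.univ.filter fun u => U.1 u ≠ 0).card ≤ 2 * k ∧
    ∀ e, (Finset.univ.filter fun t => U.2 e t ≠ 0).card ≤ k * n

open Classical in
theorem supp_add_card {T : Type} [Fintype T] (U U' : T → ZMod 2) :
    (Finset.univ.filter fun t => (U + U') t ≠ 0).card ≤
      (Finset.univ.filter fun t => U t ≠ 0).card + (Finset.univ.filter fun t => U' t ≠ 0).card := by
  refine le_trans (Finset.card_le_card ?_) (Finset.card_union_le _ _)
  intro t ht
  simp only [Finset.mem_union, Finset.mem_filter, Finset.mem_univ, true_and, Pi.add_apply] at *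
  by_contra h
  push Not at h
  exact ht (by rw [h.1, h.2, add_zero])

open Classical in
theorem bd_copy_card {n : ℕ} {T X : Type} [Fintype T] [Fintype X] (v : T → Fin 3 → X) (x0 : X)
    (m : ℕ) (hg : SysGirth v m) (U : (Fin n → ZMod 2) × (Sym2 (Fin n) → T → ZMod 2))
    (e : Sym2 (Fin n)) (hne : U.2 e ≠ 0)
    (hc : 3 * (Finset.univ.filter fun t => U.2 e t ≠ 0).card < m) :
    (Finset.univ.filter fun t => U.2 e t ≠ 0).card + 1 ≤
      (Finset.univ.filter fun x => x ≠ x0 ∧ bdG v x0 U (e, x) ≠ 0).card := by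
  have h1 := sys_expand v m hg (U.2 e) hne hc
  have h2 : (Finset.univ.filter fun x => sysBd v (U.2 e) x ≠ 0).card ≤
      (insert x0 (Finset.univ.filter fun x => x ≠ x0 ∧ bdG v x0 U (e, x) ≠ 0)).card := by
    apply Finset.card_le_card
    intro x hx
    by_cases hxx : x = x0
    · simp [hxx]
    · simpa [hxx, bdG] using hx
  have h3 := Finset.card_insert_le x0
    (Finset.univ.filter fun x => x ≠ x0 ∧ bdG v x0 U (e, x) ≠ 0)
  omega

open Classical in
theorem bd_total_copy {n : ℕ} {T X : Type} [Fintype T] [Fintype X] (v : T → Fin 3 → X) (x0 : X)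
    (m : ℕ) (hg : SysGirth v m) (U : (Fin n → ZMod 2) × (Sym2 (Fin n) → T → ZMod 2))
    (e : Sym2 (Fin n)) (hne : U.2 e ≠ 0)
    (hc : 3 * (Finset.univ.filter fun t => U.2 e t ≠ 0).card < m) :
    (Finset.univ.filter fun t => U.2 e t ≠ 0).card + 1 ≤
      (Finset.univ.filter fun p => bdG v x0 U p ≠ 0).card := by
  refine (bd_copy_card v x0 m hg U e hne hc).trans ?_
  apply Finset.card_le_card_of_injOn (fun x => (e, x))
  · intro x hx
    simp only [Finset.coe_filter, Finset.mem_univ, true_and, Set.mem_ofPred_eq] at hx ⊢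
    exact hx.2
  · intro x _ x' _ h
    simpa using h

open Classical in
theorem bd_total_vert {n : ℕ} {T X : Type} [Fintype T] [Fintype X] (v : T → Fin 3 → X) (x0 : X)
    (m : ℕ) (hg : SysGirth v m) (U : (Fin n → ZMod 2) × (Sym2 (Fin n) → T → ZMod 2))
    (hc : ∀ e, 3 * (Finset.univ.filter fun t => U.2 e t ≠ 0).card < m) :
    (Finset.univ.filter fun u => U.1 u ≠ 0).card *
      (n - (Finset.univ.filter fun u => U.1 u ≠ 0).card) ≤
      (Finset.univ.filter fun p => bdG v x0 U p ≠ 0).card := by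
  have hx : ∀ e, vBd U.1 e ≠ 0 → ∃ x, bdG v x0 U (e, x) ≠ 0 := by
    intro e he
    by_cases h0 : U.2 e = 0
    · refine ⟨x0, ?_⟩
      simpa [bdG, h0, sysBd] using he
    · have h1 := bd_copy_card v x0 m hg U e h0 (hc e)
      have h2 : 0 < (Finset.univ.filter fun x => x ≠ x0 ∧ bdG v x0 U (e, x) ≠ 0).card := by omega
      obtain ⟨x, hx⟩ := Finset.card_pos.1 h2
      exact ⟨x, (Finset.mem_filter.1 hx).2.2⟩
  set S := Finset.univ.filter fun u => U.1 u ≠ 0 with hS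
  have hcompl : n - S.card = Sᶜ.card := by rw [Finset.card_compl, Fintype.card_fin]
  rw [hcompl, ← Finset.card_product]
  have hb : ∀ q ∈ S ×ˢ Sᶜ, vBd U.1 s(q.1, q.2) ≠ 0 := by
    rintro ⟨a, b⟩ hq
    simp only [hS, Finset.mem_product, Finset.mem_compl, Finset.mem_filter, Finset.mem_univ,
      true_and, not_not] at hq
    simpa [vBd, hq.2] using hq.1
  have : Nonempty X := ⟨x0⟩
  choose! g hgx using hx
  apply Finset.card_le_card_of_injOn (fun q => (s(q.1, q.2), g s(q.1, q.2)))
  · intro q hq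
    simp only [Finset.coe_filter, Finset.mem_univ, true_and, Set.mem_ofPred_eq]
    exact hgx _ (hb q hq)
  · rintro ⟨a, b⟩ hq ⟨a', b'⟩ hq' h
    have h1 := (Prod.mk.inj h).1
    simp only [Finset.coe_product, Set.mem_prod, Finset.mem_coe, Finset.mem_compl] at hq hq'
    rcases Sym2.eq_iff.1 h1 with ⟨h2, h3⟩ | ⟨h2, h3⟩
    · simp at h2 h3; rw [h2, h3]
    · simp only at h2 h3
      exact absurd (h2 ▸ hq.1) hq'.2

theorem admG_closed {n : ℕ} {T X : Type} [Fintype T] [Fintype X] (v : T → Fin 3 → X) (x0 : X)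
    (k m : ℕ) (hn : n = 8 * k) (hm : 6 * (k * n) < m) (hg : SysGirth v m) :
    ∀ U U' : (Fin n → ZMod 2) × (Sym2 (Fin n) → T → ZMod 2), AdmG k U → AdmG k U' →
      (Finset.univ.filter fun p => bdG v x0 (U + U') p ≠ 0).card ≤ k * n → AdmG k (U + U') := by
  classical
  intro U U' hU hU' hb
  have h2 : ∀ e, (Finset.univ.filter fun t => (U + U').2 e t ≠ 0).card ≤ 2 * (k * n) := by
    intro e
    have := supp_add_card (U.2 e) (U'.2 e)
    have h3 := hU.2 e
    have h4 := hU'.2 e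
    refine this.trans ?_
    omega
  have h1 : (Finset.univ.filter fun u => (U + U').1 u ≠ 0).card ≤ 4 * k := by
    have := supp_add_card U.1 U'.1
    have h3 := hU.1
    have h4 := hU'.1
    refine le_trans ?_ (this.trans ?_)
    · exact le_of_eq (by congr!)
    · refine le_trans (add_le_add (le_trans (le_of_eq (by congr!)) h3)
        (le_trans (le_of_eq (by congr!)) h4)) ?_
      omega
  have hc : ∀ e, 3 * (Finset.univ.filter fun t => (U + U').2 e t ≠ 0).card < m := by
    intro e
    have := h2 e
    omega
  constructor
  · have h5 := bd_total_vert v x0 m hg (U + U') hc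
    have h6 := h5.trans (le_trans (le_of_eq (by congr!)) hb)
    by_contra hlt
    rw [not_le] at hlt
    have h7 : 2 * k < (Finset.univ.filter fun u => (U + U').1 u ≠ 0).card :=
      lt_of_lt_of_eq hlt (by congr!)
    clear hlt h5
    generalize (Finset.univ.filter fun u => (U + U').1 u ≠ 0).card = a at h1 h6 h7
    subst hn
    obtain ⟨b, hb⟩ : ∃ b, 8 * k - a = b := ⟨_, rfl⟩
    rw [hb] at h6
    have h8 : 4 * k ≤ b := by omega
    have h9 : (2 * k + 1) * (4 * k) ≤ a * b := Nat.mul_le_mul h7 h8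
    have h10 : 0 < k := by omega
    nlinarith
  · intro e
    by_cases h0 : (U + U').2 e = 0
    · simp [h0]
    · have h5 := bd_total_copy v x0 m hg (U + U') e h0 (hc e)
      have h6 := h5.trans (le_trans (le_of_eq (by congr!)) hb)
      omega

theorem admG_zero {n : ℕ} {T X : Type} [Fintype T] [Fintype X] (v : T → Fin 3 → X) (x0 : X)
    (k m : ℕ) (hk : 0 < k) (hn : n = 8 * k) (hm : 6 * (k * n) < m) (hg : SysGirth v m)
    (U : (Fin n → ZMod 2) × (Sym2 (Fin n) → T → ZMod 2)) (hU : AdmG k U)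
    (hb : bdG v x0 U = 0) : U = 0 := by
  classical
  have hc : ∀ e, 3 * (Finset.univ.filter fun t => U.2 e t ≠ 0).card < m := by
    intro e
    have h3 := le_trans (le_of_eq (by congr!)) (hU.2 e)
    have := Nat.mul_le_mul_left 3 h3
    omega
  have hz : (Finset.univ.filter fun p => bdG v x0 U p ≠ 0).card = 0 := by simp [hb]
  have h2 : U.2 = 0 := by
    funext e
    by_contra h0
    have h5 := bd_total_copy v x0 m hg U e h0 (by convert hc e)
    have h6 := h5.trans (le_trans (le_of_eq (by congr!)) hz.le)
    omega
  have h1 : U.1 = 0 := by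
    have h5 := bd_total_vert v x0 m hg U (fun e => by convert hc e)
    have h6 := h5.trans (le_trans (le_of_eq (by congr!)) hz.le)
    have h7 := hU.1
    rw [Nat.le_zero, mul_eq_zero] at h6
    have h8 : (Finset.univ.filter fun u => U.1 u ≠ 0).card = 0 := by
      rcases h6 with h6 | h6
      · exact h6
      · exfalso
        have h9 : (Finset.univ.filter fun u => U.1 u ≠ 0).card ≤ 2 * k :=
          le_trans (le_of_eq (by congr!)) h7
        have h10 : n - (Finset.univ.filter fun u => U.1 u ≠ 0).card = 0 := by
          exact h6
        omega
    funext u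
    by_contra hu
    rw [Finset.card_eq_zero] at h8
    have : u ∈ (Finset.univ.filter fun u => U.1 u ≠ 0) := by simpa using hu
    rw [h8] at this
    simp at this
  exact Prod.ext h1 h2

theorem sysBd_pair {T X : Type} [Fintype T] [Fintype X] (v : T → Fin 3 → X) (U : T → ZMod 2)
    (z : X → ZMod 2) : ∑ x, sysBd v U x * z x = ∑ t, U t * ∑ j, z (v t j) := by
  classical
  unfold sysBd
  simp_rw [Finset.sum_mul]
  rw [Finset.sum_comm]
  refine Finset.sum_congr rfl fun t _ => ?_
  rw [Finset.sum_comm, Finset.mul_sum]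
  refine Finset.sum_congr rfl fun j _ => ?_
  simp

theorem vBd_pair {n : ℕ} (u : Fin n) (z : Sym2 (Fin n) → ZMod 2) :
    ∑ e, vBd (Pi.single u 1) e * z e = ∑ w, if u = w then 0 else z s(u, w) := by
  symm
  apply Finset.sum_of_injOn (fun w => s(u, w))
  · intro w _ w' _ h
    exact Sym2.congr_right.1 h
  · intro w _; simp
  · intro e _ he
    induction e using Sym2.ind with
    | _ a b =>
      have ha : a ≠ u := by rintro rfl; exact he ⟨b, by simp, rfl⟩
      have hb : b ≠ u := by rintro rfl; exact he ⟨a, by simp, Sym2.eq_swap⟩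
      simp [vBd, ha, hb]
  · intro w _
    split_ifs with h
    · subst h
      simp [vBd, zmod2_add_self]
    · simp [vBd, Ne.symm h]

open Classical in
theorem OKy.triple {n : ℕ} {T X : Type} [Fintype T] [Fintype X] {v : T → Fin 3 → X} {x0 : X}
    {k : ℕ} (hk : 0 < k) (hn : 0 < n) {tw : Fin n → Fin n → ZMod 2}
    {y : Sym2 (Fin n) × X → ZMod 2} {P}
    (h : OKy (bdG v x0) (rhsG tw) (AdmG (T := T) k) y P) (e : Sym2 (Fin n)) (t : T)
    (hP : ∀ j, (e, v t j) ∈ P) : ∑ j, y (e, v t j) = 0 := by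
  have hkn : 1 ≤ k * n := Nat.mul_pos hk hn
  have h1 := h (0, Pi.single e (Pi.single t 1)) (by
      constructor
      · simp
      · intro e'
        by_cases he : e' = e
        · subst he
          refine le_trans (Finset.card_le_one.2 ?_) hkn
          intro a ha b hb
          simp [Pi.single_apply] at ha hb
          rw [ha, hb]
        · simp [he])
    (by
      rintro ⟨e', x⟩ hx
      by_cases he : e' = e
      · subst he
        simp only [bdG, AddMonoidHom.mk'_apply, Pi.single_eq_same, sysBd]
        rw [Finset.sum_eq_zero, add_zero]
        · simp only [vBd, Pi.zero_apply, add_zero]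
          induction e' using Sym2.ind with
          | _ a b => simp
        · intro t' _
          by_cases ht : t' = t
          · subst ht
            apply Finset.sum_eq_zero
            intro j _
            rw [if_neg]
            rintro rfl
            exact hx (hP j)
          · simp [ht]
      · simp only [bdG, AddMonoidHom.mk'_apply, sysBd, Pi.single_eq_of_ne he]
        simp only [vBd, Pi.zero_apply, add_zero]
        induction e' using Sym2.ind with
        | _ a b => simp)
  have h2 : ∀ e', vBd (0 : Fin n → ZMod 2) e' = 0 := by
    intro e'
    induction e' using Sym2.ind with
    | _ a b => simp [vBd]
  rw [Fintype.sum_prod_type] at h1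
  simp only [bdG, AddMonoidHom.mk'_apply, h2, ite_self, zero_add, rhsG] at h1
  rw [Finset.sum_eq_single e] at h1
  · rw [Pi.single_eq_same, sysBd_pair v _ fun x => y (e, x)] at h1
    simpa [Pi.single_apply] using h1
  · intro e' _ he
    rw [Pi.single_eq_of_ne he]
    simp [sysBd]
  · simp

open Classical in
theorem OKy.vert {n : ℕ} {T X : Type} [Fintype T] [Fintype X] {v : T → Fin 3 → X} {x0 : X}
    {k : ℕ} (hk : 0 < k) {tw : Fin n → Fin n → ZMod 2}
    {y : Sym2 (Fin n) × X → ZMod 2} {P}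
    (h : OKy (bdG v x0) (rhsG tw) (AdmG (T := T) k) y P) (u : Fin n)
    (hP : ∀ w, u ≠ w → (s(u, w), x0) ∈ P) :
    ∑ w, (if u = w then 0 else y (s(u, w), x0) + tw u w) = 0 := by
  have hz : ∀ x, sysBd v 0 x = 0 := by intro x; simp [sysBd]
  have h1 := h (Pi.single u 1, 0) (by
      constructor
      · refine le_trans (Finset.card_le_one.2 ?_) (by omega : 1 ≤ 2 * k)
        intro a ha b hb
        simp [Pi.single_apply] at ha hb
        rw [ha, hb]
      · simp)
    (by
      rintro ⟨e', x⟩ hx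
      simp only [bdG, AddMonoidHom.mk'_apply, Pi.zero_apply, hz, add_zero]
      split_ifs with hxx
      · subst hxx
        induction e' using Sym2.ind with
        | _ a b =>
          by_cases hab : a = b
          · subst hab; simp [vBd, zmod2_add_self]
          · have ha : a ≠ u := by rintro rfl; exact hx (hP b hab)
            have hb : b ≠ u := by
              rintro rfl
              apply hx
              rw [Sym2.eq_swap]
              exact hP a (Ne.symm hab)
            simp [vBd, ha, hb]
      · rfl)
  rw [Fintype.sum_prod_type] at h1
  simp only [bdG, AddMonoidHom.mk'_apply, Pi.zero_apply, hz, add_zero, rhsG] at h1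
  simp only [ite_mul, zero_mul, Finset.sum_ite_eq', Finset.mem_univ, if_true] at h1
  rw [vBd_pair u fun e => y (e, x0)] at h1
  simp only [Pi.single_apply, ite_mul, zero_mul, one_mul, Finset.sum_ite_eq', Finset.mem_univ,
    if_true] at h1
  have : ∀ w, (if u = w then 0 else y (s(u, w), x0) + tw u w) =
    (if u = w then 0 else y (s(u, w), x0)) + (if u = w then 0 else tw u w) := by
    intro w; split_ifs <;> simp
  simp_rw [this]
  rw [Finset.sum_add_distrib, h1, zmod2_add_self]

end ExtensionPart

section StructurePart

/-- The universe of the structures. -/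
abbrev Univ3 (n : ℕ) (X : Type) : Type :=
  CFIVert (⊤ : SimpleGraph (Fin n)) ⊕ ((Sym2 (Fin n) × X) × ZMod 2)

/-- Linking edge vertices with multipedes. -/
def linkR {n : ℕ} {X : Type} (x0 : X) (tw : Fin n → Fin n → ZMod 2) :
    CFIVert (⊤ : SimpleGraph (Fin n)) → ((Sym2 (Fin n) × X) × ZMod 2) → Prop
  | Sum.inl _, _ => False
  | Sum.inr e, p => p.1 = (s(e.1.val.1, e.1.val.2), x0) ∧ p.2 = e.2 + tw e.1.val.1 e.1.val.2

/-- The ternary relation. -/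
def RT {n : ℕ} {T X : Type} (v : T → Fin 3 → X) (x0 : X) (f : Sym2 (Fin n) → ZMod 2)
    (tw : Fin n → Fin n → ZMod 2) : Univ3 n X → Univ3 n X → Univ3 n X → Prop
  | Sum.inl a, Sum.inl b, Sum.inl c => b = c ∧ (a = b ∨ CFIAdj ⊤ f a b ∨ CFIAdj ⊤ f b a)
  | Sum.inl a, Sum.inl b, Sum.inr p => a = b ∧ linkR x0 tw a p
  | Sum.inr p, Sum.inr q, Sum.inr r => ∃ e t, p.1 = (e, v t 0) ∧ q.1 = (e, v t 1) ∧
      r.1 = (e, v t 2) ∧ p.2 + q.2 + r.2 = 0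
  | _, _, _ => False

/-- Class of an element. -/
def rk3 {n : ℕ} {X : Type} (idx : Sym2 (Fin n) × X → ℕ) :
    Univ3 n X → Fin n ⊕ₗ ((Fin n ×ₗ Fin n) ⊕ₗ ℕ)
  | Sum.inl (Sum.inl g) => toLex (Sum.inl g.val.1)
  | Sum.inl (Sum.inr e) => toLex (Sum.inr (toLex (Sum.inl (toLex e.1.val))))
  | Sum.inr p => toLex (Sum.inr (toLex (Sum.inr (idx p.1))))

/-- The unguarded shift of a gadget. -/
def rawSh {n : ℕ} {X : Type} (x0 : X) (tw : Fin n → Fin n → ZMod 2)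
    (y : Sym2 (Fin n) × X → ZMod 2) (u : Fin n) : Fin n → ZMod 2 :=
  fun w => if u = w then 0 else y (s(u, w), x0) + tw u w

/-- The guarded shift of a gadget. -/
def gSh {n : ℕ} {X : Type} (x0 : X) (tw : Fin n → Fin n → ZMod 2)
    (y : Sym2 (Fin n) × X → ZMod 2) (u : Fin n) : Fin n → ZMod 2 :=
  if ∑ w, rawSh x0 tw y u w = 0 then rawSh x0 tw y u else 0

theorem gSh_sum {n : ℕ} {X : Type} (x0 : X) (tw : Fin n → Fin n → ZMod 2)
    (y : Sym2 (Fin n) × X → ZMod 2) (u : Fin n) : ∑ w, gSh x0 tw y u w = 0 := by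
  unfold gSh
  split_ifs with h
  · exact h
  · simp

theorem gSh_diag {n : ℕ} {X : Type} (x0 : X) (tw : Fin n → Fin n → ZMod 2)
    (y : Sym2 (Fin n) × X → ZMod 2) (u : Fin n) : gSh x0 tw y u u = 0 := by
  unfold gSh
  split_ifs with h
  · simp [rawSh]
  · simp

/-- The action of an assignment on the universe. -/
def act3 {n : ℕ} {X : Type} (x0 : X) (tw : Fin n → Fin n → ZMod 2)
    (y : Sym2 (Fin n) × X → ZMod 2) : Univ3 n X → Univ3 n X
  | Sum.inl (Sum.inl g) => Sum.inl (Sum.inl ⟨(g.val.1, g.val.2 + gSh x0 tw y g.val.1), by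
      constructor
      · intro w hw
        have h1 := g.prop.1 w hw
        have h2 : g.val.1 = w := by simpa using hw
        simp only [Pi.add_apply]
        rw [h1, ← h2, gSh_diag, add_zero]
      · simp only [Pi.add_apply, Finset.sum_add_distrib]
        rw [g.prop.2, gSh_sum, add_zero]⟩)
  | Sum.inl (Sum.inr e) => Sum.inl (Sum.inr (e.1,
      e.2 + (y (s(e.1.val.1, e.1.val.2), x0) + tw e.1.val.1 e.1.val.2)))
  | Sum.inr p => Sum.inr (p.1, p.2 + y p.1)

open Classical in
/-- Variables covered by an element. -/
noncomputable def cov3 {n : ℕ} {X : Type} (x0 : X) : Univ3 n X → Finset (Sym2 (Fin n) × X)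
  | Sum.inl (Sum.inl g) => (Finset.univ.filter fun w => g.val.1 ≠ w).image
      fun w => (s(g.val.1, w), x0)
  | Sum.inl (Sum.inr e) => {(s(e.1.val.1, e.1.val.2), x0)}
  | Sum.inr p => {p.1}

theorem act3_act3 {n : ℕ} {X : Type} (x0 : X) (tw : Fin n → Fin n → ZMod 2)
    (y : Sym2 (Fin n) × X → ZMod 2) (a : Univ3 n X) :
    act3 x0 tw y (act3 x0 tw y a) = a := by
  rcases a with (g | e) | p
  · simp only [act3]
    congr 2
    apply Subtype.ext
    apply Prod.ext
    · rfl
    · funext w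
      simp only [Pi.add_apply, add_assoc, zmod2_add_self, add_zero]
  · simp only [act3]
    congr 2
    apply Prod.ext
    · rfl
    · simp only [add_assoc (e.2), zmod2_add_self, add_zero]
  · simp only [act3, add_assoc, zmod2_add_self, add_zero]

theorem cov3_act3 {n : ℕ} {X : Type} (x0 : X) (tw : Fin n → Fin n → ZMod 2)
    (y : Sym2 (Fin n) × X → ZMod 2) (a : Univ3 n X) :
    cov3 x0 (act3 x0 tw y a) = cov3 x0 a := by
  rcases a with (g | e) | p <;> rfl

theorem rk3_act3 {n : ℕ} {X : Type} (idx) (x0 : X) (tw : Fin n → Fin n → ZMod 2)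
    (y : Sym2 (Fin n) × X → ZMod 2) (a : Univ3 n X) :
    rk3 idx (act3 x0 tw y a) = rk3 idx a := by
  rcases a with (g | e) | p <;> rfl

theorem act3_congr {n : ℕ} {X : Type} (x0 : X) (tw : Fin n → Fin n → ZMod 2)
    (y y' : Sym2 (Fin n) × X → ZMod 2) (a : Univ3 n X) (h : ∀ p ∈ cov3 x0 a, y p = y' p) :
    act3 x0 tw y a = act3 x0 tw y' a := by
  rcases a with (g | e) | p
  · have hr : rawSh x0 tw y g.val.1 = rawSh x0 tw y' g.val.1 := by
      funext w
      unfold rawSh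
      split_ifs with hw
      · rfl
      · rw [h]
        simp only [cov3, Finset.mem_image, Finset.mem_filter, Finset.mem_univ, true_and]
        exact ⟨w, hw, rfl⟩
    have hg : gSh x0 tw y g.val.1 = gSh x0 tw y' g.val.1 := by
      unfold gSh
      rw [hr]
    simp only [act3, hg]
  · simp only [act3]
    rw [h _ (by simp [cov3])]
  · simp only [act3]
    rw [h _ (by simp [cov3])]

theorem cov3_card {n : ℕ} {X : Type} (hn : 0 < n) (x0 : X) (a : Univ3 n X) :
    (cov3 x0 a).card ≤ n := by
  classical
  rcases a with (g | e) | p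
  · refine Finset.card_image_le.trans ((Finset.card_le_univ _).trans ?_)
    simp
  · simp [cov3]; omega
  · simp [cov3]; omega

/-- Compatibility of an assignment with the twist on a set of variables. -/
theorem cfiAdj_act3 {n : ℕ} {X : Type} (x0 : X) (f : Sym2 (Fin n) → ZMod 2)
    (tw : Fin n → Fin n → ZMod 2) (hf : ∀ u w, u ≠ w → f s(u, w) = tw u w + tw w u)
    (y : Sym2 (Fin n) × X → ZMod 2) (a b a' b' : CFIVert (⊤ : SimpleGraph (Fin n)))
    (ha : act3 x0 tw y (Sum.inl a) = Sum.inl a') (hb : act3 x0 tw y (Sum.inl b) = Sum.inl b')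
    (hg : ∀ g, (a = Sum.inl g ∨ b = Sum.inl g) → ∑ w, rawSh x0 tw y g.val.1 w = 0) :
    CFIAdj ⊤ f a' b' ↔ CFIAdj ⊤ 0 a b := by
  have hge : ∀ (g : GadgetVert (⊤ : SimpleGraph (Fin n))) (e : EdgeVert (⊤ : SimpleGraph (Fin n))),
      ∑ w, rawSh x0 tw y g.val.1 w = 0 →
      ((g.val.1 = e.1.val.1 ∧ g.val.2 e.1.val.2 + gSh x0 tw y g.val.1 e.1.val.2 =
        e.2 + (y (s(e.1.val.1, e.1.val.2), x0) + tw e.1.val.1 e.1.val.2)) ↔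
      (g.val.1 = e.1.val.1 ∧ g.val.2 e.1.val.2 = e.2)) := by
    intro g e h0
    apply and_congr_right
    intro h1
    have hne : e.1.val.1 ≠ e.1.val.2 := by simpa using e.1.prop
    rw [gSh, if_pos h0, rawSh, h1, if_neg hne]
    exact add_left_inj _
  rcases a with g | e <;> rcases b with g' | e' <;>
    obtain rfl := Sum.inl_injective ha <;> obtain rfl := Sum.inl_injective hb
  · exact Iff.rfl
  · exact hge g e' (hg g (Or.inl rfl))
  · exact hge g' e (hg g' (Or.inr rfl))
  · simp only [CFIAdj]
    apply and_congr_right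
    intro h1
    apply and_congr_right
    intro h2
    have hne : e.1.val.1 ≠ e.1.val.2 := by simpa using e.1.prop
    rw [hf _ _ hne, ← h1, ← h2, Sym2.eq_swap (a := e.1.val.2)]
    simp only [Pi.zero_apply]
    have e1 := zmod2_add_self (y (s(e.1.val.1, e.1.val.2), x0))
    constructor
    · intro h
      linear_combination h - e1
    · intro h
      linear_combination h + e1

theorem act3_inl {n : ℕ} {X : Type} (x0 : X) (tw : Fin n → Fin n → ZMod 2)
    (y : Sym2 (Fin n) × X → ZMod 2) (a : CFIVert (⊤ : SimpleGraph (Fin n))) :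
    ∃ a', act3 x0 tw y (Sum.inl a) = Sum.inl a' := by
  rcases a with g | e
  · exact ⟨_, rfl⟩
  · exact ⟨_, rfl⟩

theorem RT_act3 {n : ℕ} {T X : Type} (v : T → Fin 3 → X) (x0 : X) (f : Sym2 (Fin n) → ZMod 2)
    (tw : Fin n → Fin n → ZMod 2) (hf : ∀ u w, u ≠ w → f s(u, w) = tw u w + tw w u)
    (y : Sym2 (Fin n) × X → ZMod 2) (P : Finset (Sym2 (Fin n) × X))
    (hT : ∀ e t, (∀ j, (e, v t j) ∈ P) → ∑ j, y (e, v t j) = 0)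
    (hG : ∀ u : Fin n, (∀ w, u ≠ w → (s(u, w), x0) ∈ P) → ∑ w, rawSh x0 tw y u w = 0)
    (a b c : Univ3 n X) (ha : cov3 x0 a ⊆ P) (hb : cov3 x0 b ⊆ P) (hc : cov3 x0 c ⊆ P) :
    RT v x0 0 0 a b c ↔ RT v x0 f tw (act3 x0 tw y a) (act3 x0 tw y b) (act3 x0 tw y c) := by
  have hinj : Function.Injective (act3 x0 tw y) :=
    (show Function.Involutive (act3 x0 tw y) from act3_act3 x0 tw y).injective
  have hG' : ∀ g : GadgetVert (⊤ : SimpleGraph (Fin n)),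
      cov3 x0 (Sum.inl (Sum.inl g)) ⊆ P → ∑ w, rawSh x0 tw y g.val.1 w = 0 := by
    intro g h
    apply hG
    intro w hw
    apply h
    simp only [cov3, Finset.mem_image, Finset.mem_filter, Finset.mem_univ, true_and]
    exact ⟨w, hw, rfl⟩
  have heq : ∀ a b a' b' : CFIVert (⊤ : SimpleGraph (Fin n)),
      act3 x0 tw y (Sum.inl a) = Sum.inl a' → act3 x0 tw y (Sum.inl b) = Sum.inl b' →
      (a = b ↔ a' = b') := by
    intro a b a' b' h1 h2
    rw [← Sum.inl_injective.eq_iff (a := a') (b := b'), ← h1, ← h2, hinj.eq_iff,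
      Sum.inl_injective.eq_iff]
  rcases a with a | p <;> rcases b with b | q <;> rcases c with c | r
  · obtain ⟨a', ha'⟩ := act3_inl x0 tw y a
    obtain ⟨b', hb'⟩ := act3_inl x0 tw y b
    obtain ⟨c', hc'⟩ := act3_inl x0 tw y c
    rw [ha', hb', hc']
    simp only [RT]
    rw [heq b c b' c' hb' hc', heq a b a' b' ha' hb',
      cfiAdj_act3 x0 f tw hf y a b a' b' ha' hb', cfiAdj_act3 x0 f tw hf y b a b' a' hb' ha']
    · rintro g (rfl | rfl)
      · exact hG' g hb
      · exact hG' g ha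
    · rintro g (rfl | rfl)
      · exact hG' g ha
      · exact hG' g hb
  · obtain ⟨a', ha'⟩ := act3_inl x0 tw y a
    obtain ⟨b', hb'⟩ := act3_inl x0 tw y b
    rw [ha', hb']
    simp only [RT, act3]
    rw [heq a b a' b' ha' hb']
    apply and_congr_right
    intro _
    rcases a with g | e <;> obtain rfl := Sum.inl_injective ha'
    · exact Iff.rfl
    · simp only [linkR]
      apply and_congr_right
      intro h1
      rw [h1]
      simp only [Pi.zero_apply, add_zero]
      have e1 := zmod2_add_self (tw e.1.val.1 e.1.val.2)
      constructor
      · intro h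
        linear_combination h - e1
      · intro h
        linear_combination h + e1
  · obtain ⟨a', ha'⟩ := act3_inl x0 tw y a
    obtain ⟨c', hc'⟩ := act3_inl x0 tw y c
    rw [ha', hc']
    simp only [RT, act3]
  · obtain ⟨a', ha'⟩ := act3_inl x0 tw y a
    rw [ha']
    simp only [RT, act3]
  · obtain ⟨b', hb'⟩ := act3_inl x0 tw y b
    obtain ⟨c', hc'⟩ := act3_inl x0 tw y c
    rw [hb', hc']
    simp only [RT, act3]
  · obtain ⟨b', hb'⟩ := act3_inl x0 tw y b
    rw [hb']
    simp only [RT, act3]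
  · obtain ⟨c', hc'⟩ := act3_inl x0 tw y c
    rw [hc']
    simp only [RT, act3]
  · simp only [RT, act3]
    refine exists_congr fun e => exists_congr fun t => ?_
    apply and_congr_right
    intro h1
    apply and_congr_right
    intro h2
    apply and_congr_right
    intro h3
    have hs := hT e t (by
      intro j
      fin_cases j
      · exact h1 ▸ ha (by simp [cov3])
      · exact h2 ▸ hb (by simp [cov3])
      · exact h3 ▸ hc (by simp [cov3]))
    rw [Fin.sum_univ_three] at hs
    rw [h1, h2, h3]
    constructor
    · intro h
      linear_combination h + hs
    · intro h
      linear_combination h - hs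

theorem ckEquiv_main {n : ℕ} {T X : Type} [Fintype T] [Fintype X] (v : T → Fin 3 → X) (x0 : X)
    (f : Sym2 (Fin n) → ZMod 2) (idx : Sym2 (Fin n) × X → ℕ)
    (tw : Fin n → Fin n → ZMod 2) (hf : ∀ u w, u ≠ w → f s(u, w) = tw u w + tw w u)
    (k m : ℕ) (hk : 0 < k) (hn : n = 8 * k) (hm : 6 * (k * n) < m) (hg : SysGirth v m) :
    CkEquiv k (RT v x0 0 0) (fun a b => rk3 idx a ≤ rk3 idx b)
      (RT v x0 f tw) (fun a b => rk3 idx a ≤ rk3 idx b) := by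
  classical
  have hn0 : 0 < n := by omega
  have hclosed := admG_closed v x0 k m hn hm hg
  refine ⟨{p | ∃ y, OKy (bdG v x0) (rhsG tw) (AdmG (T := T) k) y
      (Finset.univ.biUnion fun i => cov3 x0 (p.1 i)) ∧ ∀ i, p.2 i = act3 x0 tw y (p.1 i)},
    ?_, ?_, ?_⟩
  · let a0 : Univ3 n X := Sum.inr ((s(⟨0, hn0⟩, ⟨0, hn0⟩), x0), 0)
    have h0 : OKy (bdG v x0) (rhsG tw) (AdmG (T := T) k) 0 ∅ := by
      intro U hU hs
      have : U = 0 := admG_zero v x0 k m hk hn hm hg U hU (by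
        funext p; exact hs p (by simp))
      rw [this]
      simp
    obtain ⟨y, -, hy⟩ := h0.ext (K := k * n) (by convert hclosed) (cov3 x0 a0) (by
      have := cov3_card hn0 x0 a0
      rw [Finset.card_empty, zero_add]
      exact this.trans (Nat.le_mul_of_pos_left _ hk))
    refine ⟨(fun _ => a0, fun _ => act3 x0 tw y a0), y, ?_, fun i => rfl⟩
    refine hy.mono ?_
    intro p hp
    obtain ⟨i, -, hi⟩ := Finset.mem_biUnion.1 hp
    simp only [Finset.mem_union]
    exact Or.inr hi
  · rintro ⟨α, β⟩ ⟨y, hy, hβ⟩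
    simp only at hy hβ
    have hinj : Function.Injective (act3 x0 tw y) :=
      (show Function.Involutive (act3 x0 tw y) from act3_act3 x0 tw y).injective
    have hcov : ∀ i, cov3 x0 (α i) ⊆ Finset.univ.biUnion fun i => cov3 x0 (α i) := fun i =>
      Finset.subset_biUnion_of_mem (fun i => cov3 x0 (α i)) (Finset.mem_univ i)
    refine ⟨?_, ?_, ?_⟩
    · intro i j
      simp only [hβ, hinj.eq_iff]
    · intro i j
      simp only [hβ, rk3_act3]
    · intro i j l
      simp only [hβ]
      exact RT_act3 v x0 f tw hf y _ (fun e t => hy.triple hk hn0 e t)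
        (fun u => hy.vert hk u) _ _ _ (hcov i) (hcov j) (hcov l)
  · rintro ⟨α, β⟩ ⟨y, hy, hβ⟩ i
    simp only at hy hβ
    set P := (Finset.univ.erase i).biUnion fun j => cov3 x0 (α j) with hP
    have hPy : OKy (bdG v x0) (rhsG tw) (AdmG (T := T) k) y P :=
      hy.mono (Finset.biUnion_subset_biUnion_of_subset_left _ (Finset.erase_subset _ _))
    have hPc : P.card ≤ (k - 1) * n := by
      refine (Finset.card_biUnion_le_card_mul _ _ n fun j _ => cov3_card hn0 x0 _).trans ?_
      rw [Finset.card_erase_of_mem (Finset.mem_univ _), Finset.card_univ, Fintype.card_fin]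
    have hex : ∀ Q : Finset (Sym2 (Fin n) × X), ∃ y', Q.card ≤ n → ((∀ p ∈ P, y' p = y p) ∧
        OKy (bdG v x0) (rhsG tw) (AdmG (T := T) k) y' (P ∪ Q)) := by
      intro Q
      by_cases hQ : Q.card ≤ n
      · obtain ⟨y', h1, h2⟩ := hPy.ext (K := k * n) (by convert hclosed) Q (by
          have : (k - 1) * n + n = k * n := by
            rw [← Nat.succ_mul]; congr 1; omega
          omega)
        exact ⟨y', fun _ => ⟨h1, by convert h2⟩⟩
      · exact ⟨0, fun h => absurd h hQ⟩
    choose Y hY using hex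
    have hinv : Function.Involutive fun a : Univ3 n X => act3 x0 tw (Y (cov3 x0 a)) a := by
      intro a
      simp only [cov3_act3, act3_act3]
    refine ⟨hinv.toPerm, fun x => ⟨Y (cov3 x0 x), ?_, ?_⟩⟩
    · refine (hY (cov3 x0 x) (cov3_card hn0 x0 x)).2.mono ?_
      intro p hp
      obtain ⟨j, -, hj⟩ := Finset.mem_biUnion.1 hp
      by_cases hji : j = i
      · subst hji
        simp only [Function.update_self] at hj
        exact Finset.mem_union_right _ hj
      · simp only [Function.update_of_ne hji] at hj
        exact Finset.mem_union_left _
          (Finset.mem_biUnion.2 ⟨j, Finset.mem_erase.2 ⟨hji, Finset.mem_univ _⟩, hj⟩)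
    · intro j
      by_cases hji : j = i
      · subst hji
        simp only [Function.update_self]
        rfl
      · simp only [Function.update_of_ne hji, hβ]
        apply act3_congr
        intro p hp
        rw [(hY (cov3 x0 x) (cov3_card hn0 x0 x)).1]
        exact Finset.mem_biUnion.2 ⟨j, Finset.mem_erase.2 ⟨hji, Finset.mem_univ _⟩, hp⟩

end StructurePart

section RigidPart

theorem rk_pres {α β : Type} [Finite α] [LinearOrder β] (rk : α → β) (φ : α ≃ α)
    (h : ∀ a b, rk (φ a) ≤ rk (φ b) ↔ rk a ≤ rk b) (a : α) : rk (φ a) = rk a := by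
  classical
  have := Fintype.ofFinite α
  have hlt : ∀ a b, rk (φ a) < rk (φ b) ↔ rk a < rk b := by
    intro a b
    rw [← not_le, ← not_le, h]
  have hc : (Finset.univ.filter fun b => rk b < rk (φ a)).card =
      (Finset.univ.filter fun b => rk b < rk a).card := by
    symm
    apply Finset.card_bij (fun b _ => φ b)
    · intro b hb
      simpa [hlt] using hb
    · intro b _ c _ hbc
      exact φ.injective hbc
    · intro b hb
      refine ⟨φ.symm b, ?_, by simp⟩
      simp only [Finset.mem_filter, Finset.mem_univ, true_and] at hb ⊢
      rw [← hlt]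
      simpa using hb
  have key : ∀ x y : β, x < y → (∃ b, rk b = x) → 
      (Finset.univ.filter fun b => rk b < x).card < (Finset.univ.filter fun b => rk b < y).card := by
    rintro x y hxy ⟨b, rfl⟩
    apply Finset.card_lt_card
    rw [Finset.ssubset_iff_of_subset]
    · exact ⟨b, by simpa using hxy, by simp⟩
    · intro c hc
      simp only [Finset.mem_filter, Finset.mem_univ, true_and] at hc ⊢
      exact hc.trans hxy
  rcases lt_trichotomy (rk (φ a)) (rk a) with h1 | h1 | h1
  · have := key _ _ h1 ⟨φ a, rfl⟩
    omega
  · exact h1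
  · have := key _ _ h1 ⟨a, rfl⟩
    omega

theorem rk3_inr {n : ℕ} {X : Type} (idx : Sym2 (Fin n) × X → ℕ) (hidx : Function.Injective idx)
    (b : Univ3 n X) (p) (h : rk3 idx b = rk3 idx (Sum.inr p)) : ∃ i, b = Sum.inr (p.1, i) := by
  rcases b with (g | e) | q
  · have := toLex.injective h
    cases this
  · have := toLex.injective h
    have := toLex.injective (Sum.inr_injective this)
    cases this
  · have := toLex.injective h
    have := toLex.injective (Sum.inr_injective this)
    have := hidx (Sum.inr_injective this)
    exact ⟨q.2, by rw [← this]⟩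

theorem rk3_edge {n : ℕ} {X : Type} (idx : Sym2 (Fin n) × X → ℕ)
    (b : Univ3 n X) (e : EdgeVert (⊤ : SimpleGraph (Fin n)))
    (h : rk3 idx b = rk3 idx (Sum.inl (Sum.inr e))) :
    ∃ i, b = Sum.inl (Sum.inr (e.1, i)) := by
  rcases b with (g | e') | q
  · have := toLex.injective h
    cases this
  · have := toLex.injective h
    have := toLex.injective (Sum.inr_injective this)
    have := toLex.injective (Sum.inl_injective this)
    have h2 : e'.1 = e.1 := Subtype.ext this
    exact ⟨e'.2, by rw [← h2]; rfl⟩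
  · have := toLex.injective h
    have := toLex.injective (Sum.inr_injective this)
    cases this

theorem rk3_gadget {n : ℕ} {X : Type} (idx : Sym2 (Fin n) × X → ℕ)
    (b : Univ3 n X) (g : GadgetVert (⊤ : SimpleGraph (Fin n)))
    (h : rk3 idx b = rk3 idx (Sum.inl (Sum.inl g))) :
    ∃ g' : GadgetVert (⊤ : SimpleGraph (Fin n)), b = Sum.inl (Sum.inl g') ∧
      g'.val.1 = g.val.1 := by
  rcases b with (g' | e') | q
  · have := toLex.injective h
    exact ⟨g', rfl, Sum.inl_injective this⟩
  · have := toLex.injective h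
    cases this
  · have := toLex.injective h
    cases this

theorem rigid_main {n : ℕ} {T X : Type} (v : T → Fin 3 → X) (hv : SysInj v) (x0 : X)
    (idx : Sym2 (Fin n) × X → ℕ) (hidx : Function.Injective idx)
    (f1 f2 : Sym2 (Fin n) → ZMod 2) (tw1 tw2 : Fin n → Fin n → ZMod 2)
    (φ : Univ3 n X ≃ Univ3 n X) (hrk : ∀ a, rk3 idx (φ a) = rk3 idx a)
    (hR : ∀ a b c, RT v x0 f2 tw2 (φ a) (φ b) (φ c) ↔ RT v x0 f1 tw1 a b c) :
    (∀ p, φ (Sum.inr p) = Sum.inr p) ∧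
    (∀ e : EdgeVert (⊤ : SimpleGraph (Fin n)), φ (Sum.inl (Sum.inr e)) = Sum.inl (Sum.inr (e.1,
      e.2 + tw1 e.1.val.1 e.1.val.2 + tw2 e.1.val.1 e.1.val.2))) ∧
    (∀ g : GadgetVert (⊤ : SimpleGraph (Fin n)), ∃ g' : GadgetVert (⊤ : SimpleGraph (Fin n)),
      φ (Sum.inl (Sum.inl g)) = Sum.inl (Sum.inl g') ∧ g'.val.1 = g.val.1 ∧
      ∀ w, g.val.1 ≠ w → g'.val.2 w = g.val.2 w + tw1 g.val.1 w + tw2 g.val.1 w) := by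
  have hex : ∀ p : Sym2 (Fin n) × X, ∃ i, φ (Sum.inr (p, 0)) = Sum.inr (p, i) := fun p =>
    rk3_inr idx hidx _ _ (hrk (Sum.inr (p, 0)))
  choose y hy using hex
  have hy0 : ∀ p, y p = 0 := by
    rintro ⟨e, x⟩
    refine hv (fun x => y (e, x)) ?_ x
    intro t
    have h1 : RT v x0 f1 tw1 (Sum.inr ((e, v t 0), 0)) (Sum.inr ((e, v t 1), 0))
        (Sum.inr ((e, v t 2), 0)) := ⟨e, t, rfl, rfl, rfl, by simp⟩
    rw [← hR, hy, hy, hy] at h1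
    obtain ⟨_, _, _, _, _, h⟩ := h1
    rw [Fin.sum_univ_three]
    exact h
  have hp : ∀ p, φ (Sum.inr p) = Sum.inr p := by
    rintro ⟨p, i⟩
    rcases zmod2_cases i with rfl | rfl
    · rw [hy, hy0]
    · obtain ⟨j, hj⟩ := rk3_inr idx hidx _ _ (hrk (Sum.inr (p, 1)))
      rcases zmod2_cases j with rfl | rfl
      · have h2 := hy p
        rw [hy0] at h2
        have := φ.injective (hj.trans h2.symm)
        have := congrArg Prod.snd (Sum.inr_injective this)
        exact absurd (show (1 : ZMod 2) = 0 from this) (by decide)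
      · exact hj
  have he : ∀ e : EdgeVert (⊤ : SimpleGraph (Fin n)), φ (Sum.inl (Sum.inr e)) =
      Sum.inl (Sum.inr (e.1,
        e.2 + tw1 e.1.val.1 e.1.val.2 + tw2 e.1.val.1 e.1.val.2)) := by
    intro e
    obtain ⟨i, hi⟩ := rk3_edge idx _ e (hrk (Sum.inl (Sum.inr e)))
    have h1 : RT v x0 f1 tw1 (Sum.inl (Sum.inr e)) (Sum.inl (Sum.inr e))
        (Sum.inr ((s(e.1.val.1, e.1.val.2), x0), e.2 + tw1 e.1.val.1 e.1.val.2)) :=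
      ⟨rfl, rfl, rfl⟩
    rw [← hR, hi, hp] at h1
    obtain ⟨-, -, h⟩ := h1
    simp only at h
    rw [hi]
    congr 3
    rw [h, add_assoc, zmod2_add_self, add_zero]
  refine ⟨hp, he, ?_⟩
  intro g
  obtain ⟨g', hg', hu⟩ := rk3_gadget idx _ g (hrk (Sum.inl (Sum.inl g)))
  refine ⟨g', hg', hu, ?_⟩
  intro w hw
  let e : EdgeVert (⊤ : SimpleGraph (Fin n)) := (⟨(g.val.1, w), by simpa using hw⟩, g.val.2 w)
  have h1 : RT v x0 f1 tw1 (Sum.inl (Sum.inl g)) (Sum.inl (Sum.inr e)) (Sum.inl (Sum.inr e)) :=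
    ⟨rfl, Or.inr (Or.inl ⟨rfl, rfl⟩)⟩
  rw [← hR, hg', he] at h1
  obtain ⟨-, h | h | h⟩ := h1
  · cases h
  · exact h.2
  · exact h.2

theorem asym_main {n : ℕ} {T X : Type} [Finite X] [Finite (Univ3 n X)] (v : T → Fin 3 → X)
    (hv : SysInj v) (x0 : X)
    (idx : Sym2 (Fin n) × X → ℕ) (hidx : Function.Injective idx)
    (f : Sym2 (Fin n) → ZMod 2) (tw : Fin n → Fin n → ZMod 2) :
    Asymmetric (RT v x0 f tw) (fun a b => rk3 idx a ≤ rk3 idx b) := by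
  intro φ hR hle
  obtain ⟨h1, h2, h3⟩ := rigid_main v hv x0 idx hidx f f tw tw φ
    (fun a => rk_pres (rk3 idx) φ hle a) hR
  apply Equiv.ext
  rintro ((g | e) | p)
  · obtain ⟨g', hg, hu, hw⟩ := h3 g
    refine hg.trans ?_
    have : g' = g := by
      apply Subtype.ext
      apply Prod.ext hu
      funext w
      by_cases h : g.val.1 = w
      · rw [g.prop.1 w (by simpa using h), g'.prop.1 w (by simpa [hu] using h)]
      · rw [hw w h, add_assoc, zmod2_add_self, add_zero]
    rw [this]
    rfl
  · refine (h2 e).trans ?_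
    rw [add_assoc, zmod2_add_self, add_zero]
    rfl
  · exact h1 p

theorem noniso_main {n : ℕ} {T X : Type} [Finite X] [Finite (Univ3 n X)] (v : T → Fin 3 → X)
    (hv : SysInj v) (x0 : X)
    (idx : Sym2 (Fin n) × X → ℕ) (hidx : Function.Injective idx)
    (f : Sym2 (Fin n) → ZMod 2) (tw : Fin n → Fin n → ZMod 2) (u : Fin n) (hd : tw u u = 0)
    (hu : ∑ w, tw u w ≠ 0) :
    ¬ ∃ φ : Univ3 n X ≃ Univ3 n X,
      (∀ a b c, RT v x0 f tw (φ a) (φ b) (φ c) ↔ RT v x0 0 0 a b c) ∧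
      (∀ a b, rk3 idx (φ a) ≤ rk3 idx (φ b) ↔ rk3 idx a ≤ rk3 idx b) := by
  rintro ⟨φ, hR, hle⟩
  obtain ⟨h1, h2, h3⟩ := rigid_main v hv x0 idx hidx 0 f 0 tw φ
    (fun a => rk_pres (rk3 idx) φ hle a) hR
  obtain ⟨g', -, hg, hw⟩ := h3 ⟨(u, 0), by simp⟩
  apply hu
  rw [← g'.prop.2]
  apply Finset.sum_congr rfl
  intro w _
  by_cases h : u = w
  · subst h
    rw [hd, g'.prop.1 _ (by simpa using hg)]
  · rw [hw w h]
    simp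

/-- Domain formula. -/
def fDom : tsig.Formula (Fin 1) :=
  FirstOrder.Language.Relations.formula (L := tsig) (n := 3) (show tsig.Relations 3 from ())
    ![FirstOrder.Language.Term.var 0, FirstOrder.Language.Term.var 0,
      FirstOrder.Language.Term.var 0]

/-- Edge formula. -/
def fE : tsig.Formula (Fin 2) :=
  FirstOrder.Language.Relations.formula (L := tsig) (n := 3) (show tsig.Relations 3 from ())
    ![FirstOrder.Language.Term.var 0, FirstOrder.Language.Term.var 1,
      FirstOrder.Language.Term.var 1] ⊓
  FirstOrder.Language.BoundedFormula.not
    (FirstOrder.Language.Term.equal (FirstOrder.Language.Term.var 0)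
      (FirstOrder.Language.Term.var 1))

/-- Order formula. -/
def fLe : tsig.Formula (Fin 2) :=
  FirstOrder.Language.Relations.formula (L := tsig) (n := 2) (show tsig.Relations 2 from ())
    ![FirstOrder.Language.Term.var 0, FirstOrder.Language.Term.var 1]

theorem real_dom {α : Type} (R : α → α → α → Prop) (le : α → α → Prop) (x : α) :
    realizeIn R le fDom (fun _ => x) ↔ R x x x := by
  let _ := tStruct R le
  unfold realizeIn fDom
  rw [FirstOrder.Language.Formula.realize_rel]
  exact Iff.rfl

theorem real_E {α : Type} (R : α → α → α → Prop) (le : α → α → Prop) (x y : α) :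
    realizeIn R le fE ![x, y] ↔ R x y y ∧ x ≠ y := by
  let _ := tStruct R le
  unfold realizeIn fE
  rw [FirstOrder.Language.Formula.realize_inf, FirstOrder.Language.Formula.realize_rel,
    FirstOrder.Language.Formula.realize_not, FirstOrder.Language.Formula.realize_equal]
  exact Iff.rfl

theorem real_le {α : Type} (R : α → α → α → Prop) (le : α → α → Prop) (x y : α) :
    realizeIn R le fLe ![x, y] ↔ le x y := by
  let _ := tStruct R le
  unfold realizeIn fLe
  rw [FirstOrder.Language.Formula.realize_rel]
  exact Iff.rfl

theorem interp_main {n : ℕ} {T X : Type} (v : T → Fin 3 → X)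
    (hv : ∀ t, v t 0 ≠ v t 1) (x0 : X) (idx : Sym2 (Fin n) × X → ℕ)
    (f : Sym2 (Fin n) → ZMod 2) (tw : Fin n → Fin n → ZMod 2) :
    InterpIsoCFI (RT v x0 f tw) (fun a b => rk3 idx a ≤ rk3 idx b) fDom fE fLe
      (⊤ : SimpleGraph (Fin n)) f := by
  have hdom : ∀ a : CFIVert (⊤ : SimpleGraph (Fin n)),
      RT v x0 f tw (Sum.inl a) (Sum.inl a) (Sum.inl a) := fun a => ⟨rfl, Or.inl rfl⟩
  have hnd : ∀ p, ¬ RT v x0 f tw (Sum.inr p) (Sum.inr p) (Sum.inr p) := by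
    rintro p ⟨e, t, h0, h1, -⟩
    exact hv t (congrArg Prod.snd (h0.symm.trans h1))
  let ι : CFIVert (⊤ : SimpleGraph (Fin n)) → {x : Univ3 n X //
      realizeIn (RT v x0 f tw) (fun a b => rk3 idx a ≤ rk3 idx b) fDom (fun _ => x)} :=
    fun a => ⟨Sum.inl a, (real_dom _ _ _).2 (hdom a)⟩
  have hι : Function.Bijective ι := by
    constructor
    · intro a b h
      exact Sum.inl_injective (congrArg Subtype.val h)
    · rintro ⟨a | p, h⟩
      · exact ⟨a, rfl⟩
      · exact absurd ((real_dom _ _ _).1 h) (hnd p)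
  refine ⟨(Equiv.ofBijective ι hι).symm, ?_, ?_⟩
  · intro x y
    obtain ⟨a, rfl⟩ := hι.2 x
    obtain ⟨b, rfl⟩ := hι.2 y
    rw [real_E, Equiv.ofBijective_symm_apply_apply, Equiv.ofBijective_symm_apply_apply]
    show ((b = b ∧ (a = b ∨ CFIAdj ⊤ f a b ∨ CFIAdj ⊤ f b a)) ∧
      (Sum.inl a : Univ3 n X) ≠ Sum.inl b) ↔ (SimpleGraph.fromRel (CFIAdj ⊤ f)).Adj a b
    rw [SimpleGraph.fromRel_adj, Sum.inl_injective.ne_iff]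
    tauto
  · intro x y
    obtain ⟨a, rfl⟩ := hι.2 x
    obtain ⟨b, rfl⟩ := hι.2 y
    rw [real_le, Equiv.ofBijective_symm_apply_apply, Equiv.ofBijective_symm_apply_apply]
    show rk3 idx (Sum.inl a) ≤ rk3 idx (Sum.inl b) ↔ _
    rcases a with g | e <;> rcases b with g' | e'
    · simp only [rk3, cfiLe, CFIorigin]
      exact Sum.Lex.inl_le_inl_iff
    · simp only [rk3, cfiLe, CFIorigin, iff_true]
      exact Sum.Lex.inl_le_inr _ _
    · simp only [rk3, cfiLe, CFIorigin, iff_false]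
      exact Sum.Lex.not_inr_le_inl
    · simp only [rk3, cfiLe, CFIorigin]
      refine Sum.Lex.inr_le_inr_iff.trans (Sum.Lex.inl_le_inl_iff.trans ?_)
      exact Prod.Lex.toLex_le_toLex

end RigidPart

/-- There is a fixed 1-dimensional equivalence-free first-order
interpretation `Θ = (φdom, φE, φle)` such that for every `k ≥ 3` there are two finite
asymmetric ternary structures with total preorders that are non-isomorphic but
`C^k`-equivalent, and whose images under `Θ` are non-isomorphic CFI graphs over the same
connected ordered base graph. -/
theorem exists_hard_asymmetric_structures :
    ∃ (φdom : tsig.Formula (Fin 1)) (φE φle : tsig.Formula (Fin 2)),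
      ∀ k : ℕ, 3 ≤ k →
        ∃ (A B : Type) (_ : Fintype A) (_ : Fintype B)
          (RA : A → A → A → Prop) (leA : A → A → Prop)
          (RB : B → B → B → Prop) (leB : B → B → Prop),
          (Transitive leA ∧ Total leA) ∧ (Transitive leB ∧ Total leB) ∧
          Asymmetric RA leA ∧ Asymmetric RB leB ∧
          CkEquiv k RA leA RB leB ∧
          (¬ ∃ e : A ≃ B,
            (∀ a b c, RB (e a) (e b) (e c) ↔ RA a b c) ∧
            (∀ a b, leB (e a) (e b) ↔ leA a b)) ∧
          ∃ (VH : Type) (_ : Fintype VH) (_ : LinearOrder VH)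
            (H : SimpleGraph VH) (f g : Sym2 VH → ZMod 2),
            H.Connected ∧
            (∑ᶠ e ∈ H.edgeSet, f e) ≠ (∑ᶠ e ∈ H.edgeSet, g e) ∧
            InterpIsoCFI RA leA φdom φE φle H f ∧
            InterpIsoCFI RB leB φdom φE φle H g := by
  refine ⟨fDom, fE, fLe, ?_⟩
  intro k hk
  obtain ⟨T, X, hT, hX, ⟨x0⟩, v, hv, hg⟩ := exists_sys (6 * (k * (8 * k)) + 3)
  have hTf := Fintype.ofFinite T
  have hXf := Fintype.ofFinite X
  have hd := sys_distinct v _ (by omega) hg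
  have hn : 1 < 8 * k := by omega
  generalize hN : 8 * k = n at *
  have hfin : Finite (Univ3 n X) := by
    have h1 : Finite (GadgetVert (⊤ : SimpleGraph (Fin n))) := by
      unfold GadgetVert; infer_instance
    have h2 : Finite (EdgeVert (⊤ : SimpleGraph (Fin n))) := by
      unfold EdgeVert; infer_instance
    have h3 : Finite (CFIVert (⊤ : SimpleGraph (Fin n))) := by
      unfold CFIVert; infer_instance
    infer_instance
  have hff := Fintype.ofFinite (Univ3 n X)
  obtain ⟨idx, hidx⟩ : ∃ idx : Sym2 (Fin n) × X → ℕ, Function.Injective idx :=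
    ⟨fun p => (Finite.equivFin _ p).val, fun p q h =>
      (Finite.equivFin _).injective (Fin.ext h)⟩
  let i0 : Fin n := ⟨0, by omega⟩
  let i1 : Fin n := ⟨1, hn⟩
  have hi : i0 ≠ i1 := by
    intro h
    exact absurd (congrArg Fin.val h) (by simp [i0, i1])
  let tw : Fin n → Fin n → ZMod 2 := fun u w => if u = i0 ∧ w = i1 then 1 else 0
  let f : Sym2 (Fin n) → ZMod 2 := fun e => if e = s(i0, i1) then 1 else 0
  have hf : ∀ u w, u ≠ w → f s(u, w) = tw u w + tw w u := by
    intro u w huw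
    simp only [f, tw, Sym2.eq_iff]
    by_cases h1 : u = i0 ∧ w = i1
    · have h2 : ¬ (w = i0 ∧ u = i1) := fun h => hi (h1.1.symm.trans h.2)
      rw [if_pos (Or.inl h1), if_pos h1, if_neg h2, add_zero]
    · by_cases h2 : w = i0 ∧ u = i1
      · rw [if_pos (Or.inr h2.symm), if_neg h1, if_pos h2, zero_add]
      · rw [if_neg h1, if_neg h2, if_neg, add_zero]
        rintro (h | h)
        · exact h1 h
        · exact h2 h.symm
  have hpre : Transitive (fun a b : Univ3 n X => rk3 idx a ≤ rk3 idx b) ∧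
      Total (fun a b : Univ3 n X => rk3 idx a ≤ rk3 idx b) :=
    ⟨fun a b c h1 h2 => le_trans h1 h2, fun a b => le_total _ _⟩
  refine ⟨Univ3 n X, Univ3 n X, hff, hff, RT v x0 0 0, fun a b => rk3 idx a ≤ rk3 idx b,
    RT v x0 f tw, fun a b => rk3 idx a ≤ rk3 idx b, hpre, hpre,
    asym_main v hv x0 idx hidx 0 0, asym_main v hv x0 idx hidx f tw,
    ckEquiv_main v x0 f idx tw hf k _ (by omega) hN.symm (by omega) hg,
    noniso_main v hv x0 idx hidx f tw i0 ?_ ?_,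
    Fin n, inferInstance, inferInstance, ⊤, 0, f, ?_, ?_,
    interp_main v hd x0 idx 0 0, interp_main v hd x0 idx f tw⟩
  · exact if_neg fun h => hi h.2
  · rw [Finset.sum_eq_single i1]
    · simp [tw]
    · intro w _ hw
      exact if_neg fun h => hw h.2
    · simp
  · have : Nonempty (Fin n) := ⟨i0⟩
    exact SimpleGraph.connected_top
  · have h1 : ∑ᶠ e ∈ (⊤ : SimpleGraph (Fin n)).edgeSet, f e = 1 := by
      rw [finsum_eq_single _ s(i0, i1)]
      · rw [finsum_eq_if, if_pos (by simpa using hi)]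
        simp [f]
      · intro e he
        have : f e = 0 := if_neg he
        simp [this]
    rw [h1]
    simp
end
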